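/- (Time regularity of the implicit method.) There is a constant C > 0 depending only on d, μ, L_A, M and B (in particular independent of Δx, Δt, n and m) such that ‖Ū^n − Ū^m‖_{L¹(ℝ^d)} ≤ C √(|n−m| Δt) for all integers n, m ≥ 0. If moreover ∫_{ℝ^d} min(|z|,1) dμ(z) < ∞, then there is a constant C' > 0 depending only on d, μ, L_A, M, B and ∫ min(|z|,1) dμ such that ‖Ū^n − Ū^m‖_{L¹(ℝ^d)} ≤ C' |n−m| Δt for all integers n, m ≥ 0. -/

import Mathlib

open MeasureTheory Set

noncomputable section

abbrev Ed (d : ℕ) := EuclideanSpace ℝ (Fin d)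

def cell (d : ℕ) (dx : ℝ) (α : Fin d → ℤ) : Set (Ed d) :=
  {x | ∀ i, dx * (α i : ℝ) < x i ∧ x i < dx * (α i : ℝ) + dx}

def ind (d : ℕ) (S : Set (Ed d)) : Ed d → ℝ :=
  S.indicator fun _ => 1

def gam (d : ℕ) (dx : ℝ) (μ : Measure (Ed d)) (l : Fin d) : ℝ :=
  - ∫ z in {z : Ed d | dx / 2 < ‖z‖ ∧ ‖z‖ ≤ 1}, z l ∂μ

def Dup (d : ℕ) (dx : ℝ) (μ : Measure (Ed d)) (l : Fin d) (φ : Ed d → ℝ) (x : Ed d) : ℝ :=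
  if 0 < gam d dx μ l then (φ (x + EuclideanSpace.single l dx) - φ x) / dx
  else (φ x - φ (x - EuclideanSpace.single l dx)) / dx

def Glow (d : ℕ) (dx : ℝ) (μ : Measure (Ed d)) (α β : Fin d → ℤ) : ℝ :=
  (dx ^ d)⁻¹ *
    ∫ x in cell d dx α, ∫ z in {z : Ed d | dx / 2 < ‖z‖},
      (ind d (cell d dx β) (x + z) - ind d (cell d dx β) x) ∂μ

def Gup (d : ℕ) (dx : ℝ) (μ : Measure (Ed d)) (α β : Fin d → ℤ) : ℝ :=
  (dx ^ d)⁻¹ *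
    ∑ l : Fin d, gam d dx μ l * ∫ x in cell d dx α, Dup d dx μ l (ind d (cell d dx β)) x

def Gw (d : ℕ) (dx : ℝ) (μ : Measure (Ed d)) (α β : Fin d → ℤ) : ℝ :=
  Glow d dx μ α β + Gup d dx μ α β

def GsplitLow (d : ℕ) (dx r : ℝ) (μ : Measure (Ed d)) (α β : Fin d → ℤ) : ℝ :=
  (dx ^ d)⁻¹ *
    ∫ x in cell d dx α, ∫ z in {z : Ed d | dx / 2 < ‖z‖ ∧ ‖z‖ ≤ r},
      (ind d (cell d dx β) (x + z) - ind d (cell d dx β) x) ∂μ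

def GsplitHigh (d : ℕ) (dx r : ℝ) (μ : Measure (Ed d)) (α β : Fin d → ℤ) : ℝ :=
  (dx ^ d)⁻¹ *
      ∫ x in cell d dx α, ∫ z in {z : Ed d | r < ‖z‖},
        (ind d (cell d dx β) (x + z) - ind d (cell d dx β) x) ∂μ
    + Gup d dx μ α β

def Aok (A : ℝ → ℝ) (LA : ℝ) : Prop :=
  Monotone A ∧ (∀ a b : ℝ, |A a - A b| ≤ LA * |a - b|) ∧ A 0 = 0

def SolvesImplicitStep (d : ℕ) (dx : ℝ) (μ : Measure (Ed d)) (A : ℝ → ℝ) (dt : ℝ)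
    (u h : (Fin d → ℤ) → ℝ) : Prop :=
  ∀ α, Summable (fun β => Gw d dx μ α β * A (u β)) ∧
    u α - dt * ∑' β, Gw d dx μ α β * A (u β) = h α

def Fractional (d : ℕ) (μ : Measure (Ed d)) (lam clam : ℝ) : Prop :=
  ∀ B : Set (Ed d), MeasurableSet B → B ⊆ {z : Ed d | 0 < ‖z‖ ∧ ‖z‖ < 1} →
    μ B ≤ ∫⁻ z in B, ENNReal.ofReal (clam * ‖z‖ ^ (-(d : ℝ) - lam))

def Lhat (d : ℕ) (dx : ℝ) (μ : Measure (Ed d)) (w : Ed d → ℝ) (x : Ed d) : ℝ :=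
  (∫ z in {z : Ed d | dx / 2 < ‖z‖}, (w (x + z) - w x) ∂μ) +
    ∑ l : Fin d, gam d dx μ l * Dup d dx μ l w x

def Ubar (d : ℕ) (dx : ℝ) (U : (Fin d → ℤ) → ℝ) (x : Ed d) : ℝ :=
  ∑' α : Fin d → ℤ, U α * ind d (cell d dx α) x

def cellAvg (d : ℕ) (dx : ℝ) (w : Ed d → ℝ) (x : Ed d) : ℝ :=
  ∑' α : Fin d → ℤ, Set.indicator (cell d dx α)
    (fun _ => (dx ^ d)⁻¹ * ∫ y in cell d dx α, w y) x

open scoped ENNReal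

/-- The `ℓ¹` norm of a real family, with values in `[0, ∞]`. -/
def l1norm {ι : Type*} (f : ι → ℝ) : ℝ≥0∞ := ∑' i, ‖f i‖ₑ

/-- Translation of a function on an additive group. -/
def shift {G : Type*} [Add G] (v : G) (f : G → ℝ) : G → ℝ := fun α => f (α + v)

/-- The `ℓ¹` length of a lattice vector. -/
def latticeLen {d : ℕ} (κ : Fin d → ℤ) : ℕ := ∑ i, (κ i).natAbs

/-- The generator of the compound Poisson process on a group with jump measure `ν`. -/
def jumpGen {G : Type*} [Add G] [MeasurableSpace G] (ν : Measure G) (a : G → ℝ) : G → ℝ :=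
  fun α => ∫ κ, (a (α + κ) - a α) ∂ν

section L1norm

variable {ι : Type*} (f g : ι → ℝ)

lemma l1norm_add_le : l1norm (f + g) ≤ l1norm f + l1norm g := by
  unfold l1norm
  rw [← ENNReal.tsum_add]
  exact ENNReal.tsum_le_tsum fun i => enorm_add_le _ _

lemma l1norm_sub_le : l1norm (f - g) ≤ l1norm f + l1norm g := by
  unfold l1norm
  rw [← ENNReal.tsum_add]
  exact ENNReal.tsum_le_tsum fun i => enorm_sub_le

lemma l1norm_smul (c : ℝ) : l1norm (c • f) = ‖c‖ₑ * l1norm f := by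
  unfold l1norm
  rw [← ENNReal.tsum_mul_left]
  exact tsum_congr fun i => enorm_mul _ _

lemma l1norm_sub_comm : l1norm (f - g) = l1norm (g - f) := by
  unfold l1norm
  exact tsum_congr fun i => enorm_sub_rev _ _

lemma l1norm_zero : l1norm (0 : ι → ℝ) = 0 := by simp [l1norm]

lemma l1norm_sum_le {κ : Type*} (s : Finset κ) (F : κ → ι → ℝ) :
    l1norm (∑ k ∈ s, F k) ≤ ∑ k ∈ s, l1norm (F k) := by
  classical
  induction s using Finset.induction_on with
  | empty => simp [l1norm_zero]
  | insert a s ha ih =>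
    rw [Finset.sum_insert ha, Finset.sum_insert ha]
    exact (l1norm_add_le _ _).trans (by gcongr)

variable {f g}

lemma l1norm_sub_le_sub_add_sub (h : ι → ℝ) :
    l1norm (f - g) ≤ l1norm (f - h) + l1norm (h - g) := by
  have := l1norm_add_le (f - h) (h - g)
  rwa [sub_add_sub_cancel] at this

lemma l1norm_le_l1norm (c : ℝ≥0∞) (h : ∀ i, ‖f i‖ₑ ≤ c * ‖g i‖ₑ) : l1norm f ≤ c * l1norm g := by
  unfold l1norm
  rw [← ENNReal.tsum_mul_left]
  exact ENNReal.tsum_le_tsum h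

lemma l1norm_eq_ofReal_tsum (hf : Summable fun i => |f i|) :
    l1norm f = ENNReal.ofReal (∑' i, |f i|) := by
  unfold l1norm
  rw [ENNReal.ofReal_tsum_of_nonneg (fun _ => abs_nonneg _) hf]
  exact tsum_congr fun i => by rw [← Real.norm_eq_abs, ofReal_norm]

lemma l1norm_ne_top (hf : Summable fun i => |f i|) : l1norm f ≠ ⊤ := by
  rw [l1norm_eq_ofReal_tsum hf]
  exact ENNReal.ofReal_ne_top

lemma abs_le_toReal_l1norm (hf : l1norm f ≠ ⊤) (i : ι) : |f i| ≤ (l1norm f).toReal := by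
  have h : ‖f i‖ₑ ≤ l1norm f := ENNReal.le_tsum i
  simpa using ENNReal.toReal_mono hf h

end L1norm

section Shift

variable {G : Type*} [AddCommGroup G]

lemma l1norm_shift (v : G) (f : G → ℝ) : l1norm (shift v f) = l1norm f :=
  (Equiv.addRight v).tsum_eq fun α => ‖f α‖ₑ

lemma shift_sub (v : G) (f g : G → ℝ) : shift v (f - g) = shift v f - shift v g := rfl

lemma shift_shift (v w : G) (f : G → ℝ) : shift v (shift w f) = shift (v + w) f := by
  funext α
  simp [shift, add_assoc]

lemma shift_zero (f : G → ℝ) : shift 0 f = f := by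
  funext α
  simp [shift]

lemma l1norm_shift_sub_self_le (v : G) (f : G → ℝ) :
    l1norm (shift v f - f) ≤ 2 * l1norm f := by
  refine (l1norm_sub_le _ _).trans ?_
  rw [l1norm_shift, two_mul]

lemma l1norm_shift_neg_sub_self (v : G) (f : G → ℝ) :
    l1norm (shift (-v) f - f) = l1norm (shift v f - f) := by
  rw [← l1norm_shift v, shift_sub, shift_shift, add_neg_cancel, shift_zero, l1norm_sub_comm]

end Shift

section Lattice

variable {d : ℕ}

lemma latticeLen_add_single_of_nonneg (κ : Fin d → ℤ) (l : Fin d) (h : 0 ≤ κ l) :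
    latticeLen (κ + Pi.single l 1) = latticeLen κ + 1 := by
  unfold latticeLen
  rw [← Finset.add_sum_erase _ _ (Finset.mem_univ l),
    ← Finset.add_sum_erase _ (fun i => (κ i).natAbs) (Finset.mem_univ l)]
  have : ∑ x ∈ Finset.univ.erase l, ((κ + Pi.single l 1 : Fin d → ℤ) x).natAbs
      = ∑ x ∈ Finset.univ.erase l, (κ x).natAbs :=
    Finset.sum_congr rfl fun x hx => by simp [Pi.single_eq_of_ne (Finset.ne_of_mem_erase hx)]
  rw [this]
  simp only [Pi.add_apply, Pi.single_eq_same]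
  omega

lemma latticeLen_neg (κ : Fin d → ℤ) : latticeLen (-κ) = latticeLen κ := by
  simp [latticeLen]

lemma latticeLen_add_single_of_nonpos (κ : Fin d → ℤ) (l : Fin d) (h : κ l ≤ 0) :
    latticeLen (κ + Pi.single l (-1)) = latticeLen κ + 1 := by
  have := latticeLen_add_single_of_nonneg (-κ) l (by simpa using h)
  rw [latticeLen_neg, ← latticeLen_neg] at this
  rw [← this]
  congr 1
  simp [Pi.single_neg, add_comm]

/-- Induction along monotone lattice paths issuing from the origin. -/
lemma lattice_induction {P : (Fin d → ℤ) → Prop} (zero : P 0)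
    (pos : ∀ κ l, 0 ≤ κ l → P κ → P (κ + Pi.single l 1))
    (neg : ∀ κ l, κ l ≤ 0 → P κ → P (κ + Pi.single l (-1))) (κ : Fin d → ℤ) : P κ := by
  induction hn : latticeLen κ using Nat.strong_induction_on generalizing κ with
  | _ n ih =>
    subst hn
    by_cases h0 : κ = 0
    · exact h0 ▸ zero
    obtain ⟨l, hl⟩ := Function.ne_iff.1 h0
    rcases lt_or_gt_of_ne hl with h | h
    · have hκ : κ = (κ + Pi.single l 1) + Pi.single l (-1) := by
        rw [add_assoc, ← Pi.single_add]; simp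
      have hl' : (κ + Pi.single l 1 : Fin d → ℤ) l ≤ 0 := by
        simp only [Pi.zero_apply] at h
        simp; omega
      have := latticeLen_add_single_of_nonpos _ l hl'
      rw [← hκ] at this
      rw [hκ]
      exact neg _ l hl' (ih _ (by omega) _ rfl)
    · have hκ : κ = (κ + Pi.single l (-1)) + Pi.single l 1 := by
        rw [add_assoc, ← Pi.single_add]; simp
      have hl' : 0 ≤ (κ + Pi.single l (-1) : Fin d → ℤ) l := by
        simp only [Pi.zero_apply] at h
        simp; omega
      have := latticeLen_add_single_of_nonneg _ l hl'
      rw [← hκ] at this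
      rw [hκ]
      exact pos _ l hl' (ih _ (by omega) _ rfl)

lemma l1norm_shift_sub_self_le_latticeLen (f : (Fin d → ℤ) → ℝ) (V : ℝ≥0∞)
    (hV : ∀ l, l1norm (shift (Pi.single l 1) f - f) ≤ V) (κ : Fin d → ℤ) :
    l1norm (shift κ f - f) ≤ latticeLen κ * V := by
  have step : ∀ κ v : Fin d → ℤ, l1norm (shift v f - f) ≤ V →
      latticeLen (κ + v) = latticeLen κ + 1 →
      l1norm (shift κ f - f) ≤ latticeLen κ * V →
      l1norm (shift (κ + v) f - f) ≤ latticeLen (κ + v) * V := by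
    intro κ v hv hlen ih
    refine (l1norm_sub_le_sub_add_sub (shift κ f)).trans ?_
    rw [← shift_shift, ← shift_sub, l1norm_shift, hlen, Nat.cast_succ, add_mul, one_mul, add_comm]
    gcongr
  induction κ using lattice_induction with
  | zero => simp [shift_zero, l1norm_zero]
  | pos κ l h ih => exact step κ _ (hV l) (latticeLen_add_single_of_nonneg κ l h) ih
  | neg κ l h ih =>
    refine step κ _ ?_ (latticeLen_add_single_of_nonpos κ l h) ih
    rw [Pi.single_neg, l1norm_shift_neg_sub_self]
    exact hV l

/-- The first-order Taylor remainder of a lattice function, with forward differences. -/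
def taylorRem (f : (Fin d → ℤ) → ℝ) (κ : Fin d → ℤ) : (Fin d → ℤ) → ℝ :=
  shift κ f - f - ∑ l, (κ l : ℝ) • (shift (Pi.single l 1) f - f)

lemma sum_add_single_smul {E : Type*} [AddCommGroup E] [Module ℝ E] (κ : Fin d → ℤ) (l : Fin d)
    (n : ℤ) (F : Fin d → E) :
    ∑ i, (((κ + Pi.single l n : Fin d → ℤ) i : ℤ) : ℝ) • F i
      = ∑ i, (κ i : ℝ) • F i + (n : ℝ) • F l := by
  have : (n : ℝ) • F l = ∑ i, (((Pi.single l n : Fin d → ℤ) i : ℤ) : ℝ) • F i := by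
    rw [Finset.sum_eq_single l]
    · simp
    · intro i _ hi; simp [hi]
    · simp
  rw [this, ← Finset.sum_add_distrib]
  exact Finset.sum_congr rfl fun i _ => by rw [← add_smul]; simp

lemma l1norm_taylorRem_le (f : (Fin d → ℤ) → ℝ) (S : ℝ≥0∞)
    (hS : ∀ l m, l1norm (shift (Pi.single m 1) (shift (Pi.single l 1) f - f)
      - (shift (Pi.single l 1) f - f)) ≤ S) (κ : Fin d → ℤ) :
    l1norm (taylorRem f κ) ≤ (latticeLen κ) ^ 2 * S := by
  have hD : ∀ l (κ : Fin d → ℤ), l1norm (shift κ (shift (Pi.single l 1) f - f)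
      - (shift (Pi.single l 1) f - f)) ≤ latticeLen κ * S := fun l κ =>
    l1norm_shift_sub_self_le_latticeLen _ S (hS l) κ
  induction κ using lattice_induction with
  | zero => simp [taylorRem, shift_zero, l1norm_zero]
  | pos κ l h ih =>
    have hlen := latticeLen_add_single_of_nonneg κ l h
    have e : taylorRem f (κ + Pi.single l 1) = taylorRem f κ +
        (shift κ (shift (Pi.single l 1) f - f) - (shift (Pi.single l 1) f - f)) := by
      unfold taylorRem
      rw [sum_add_single_smul, shift_sub, shift_shift, Int.cast_one, one_smul]
      abel
    rw [e, hlen]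
    refine ((l1norm_add_le _ _).trans (add_le_add ih (hD l κ))).trans ?_
    rw [← add_mul]
    gcongr
    norm_cast
    nlinarith
  | neg κ l h ih =>
    have hlen := latticeLen_add_single_of_nonpos κ l h
    have e : taylorRem f (κ + Pi.single l (-1)) = taylorRem f κ -
        (shift (κ + Pi.single l (-1)) (shift (Pi.single l 1) f - f)
          - (shift (Pi.single l 1) f - f)) := by
      unfold taylorRem
      rw [sum_add_single_smul, shift_sub, shift_shift, add_assoc, ← Pi.single_add]
      simp only [Int.reduceNeg, Int.reduceAdd, Pi.single_zero, add_zero, Int.cast_neg, Int.cast_one,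
        neg_smul, one_smul]
      abel
    rw [e]
    refine ((l1norm_sub_le _ _).trans (add_le_add ih (hD l _))).trans ?_
    rw [hlen, ← add_mul]
    gcongr
    norm_cast
    nlinarith

end Lattice

section Average

variable {G : Type*} [AddCommGroup G]

/-- Average of the translates of `f` by `0, v, …, (k - 1) v`. -/
def lineAvg (k : ℕ) (v : G) (f : G → ℝ) : G → ℝ :=
  (k : ℝ)⁻¹ • ∑ j ∈ Finset.range k, shift (j • v) f

/-- Iterated average of `f` along the directions in a list. -/
def boxAvg (k : ℕ) (L : List G) (f : G → ℝ) : G → ℝ := L.foldr (lineAvg k) f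

lemma lineAvg_sub (k : ℕ) (v : G) (f g : G → ℝ) :
    lineAvg k v (f - g) = lineAvg k v f - lineAvg k v g := by
  simp [lineAvg, shift_sub, Finset.sum_sub_distrib, smul_sub]

lemma shift_lineAvg (k : ℕ) (v w : G) (f : G → ℝ) :
    shift w (lineAvg k v f) = lineAvg k v (shift w f) := by
  funext α
  simp [lineAvg, shift, add_right_comm]

lemma boxAvg_sub (k : ℕ) (L : List G) (f g : G → ℝ) :
    boxAvg k L (f - g) = boxAvg k L f - boxAvg k L g := by
  induction L with
  | nil => rfl
  | cons v L ih =>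
    change lineAvg k v (boxAvg k L (f - g)) = _
    rw [ih, lineAvg_sub]
    rfl

lemma boxAvg_smul (k : ℕ) (L : List G) (c : ℝ) (f : G → ℝ) :
    boxAvg k L (c • f) = c • boxAvg k L f := by
  induction L with
  | nil => rfl
  | cons v L ih =>
    change lineAvg k v (boxAvg k L (c • f)) = c • lineAvg k v (boxAvg k L f)
    rw [ih, lineAvg, lineAvg, smul_comm c]
    congr 1
    rw [Finset.smul_sum]
    rfl

lemma shift_boxAvg (k : ℕ) (L : List G) (w : G) (f : G → ℝ) :
    shift w (boxAvg k L f) = boxAvg k L (shift w f) := by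
  induction L with
  | nil => rfl
  | cons v L ih =>
    change shift w (lineAvg k v (boxAvg k L f)) = _
    rw [shift_lineAvg, ih]
    rfl

lemma inv_natCast_mul_self {k : ℕ} (hk : k ≠ 0) : ‖(k : ℝ)⁻¹‖ₑ * (k : ℝ≥0∞) = 1 := by
  rw [enorm_inv (by exact_mod_cast hk), Real.enorm_natCast]
  exact ENNReal.inv_mul_cancel (by exact_mod_cast hk) (ENNReal.natCast_ne_top k)

lemma l1norm_lineAvg_le {k : ℕ} (hk : k ≠ 0) (v : G) (f : G → ℝ) :
    l1norm (lineAvg k v f) ≤ l1norm f := by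
  unfold lineAvg
  rw [l1norm_smul]
  calc _ ≤ ‖(k : ℝ)⁻¹‖ₑ * ∑ j ∈ Finset.range k, l1norm (shift (j • v) f) := by
        gcongr; exact l1norm_sum_le _ _
    _ = l1norm f := by
        simp only [l1norm_shift, Finset.sum_const, Finset.card_range, nsmul_eq_mul]
        rw [← mul_assoc, inv_natCast_mul_self hk, one_mul]

lemma l1norm_boxAvg_le {k : ℕ} (hk : k ≠ 0) (L : List G) (f : G → ℝ) :
    l1norm (boxAvg k L f) ≤ l1norm f := by
  induction L with
  | nil => rfl
  | cons v L ih => exact (l1norm_lineAvg_le hk v _).trans ih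

lemma l1norm_shift_nsmul_sub_self_le (j : ℕ) (v : G) (f : G → ℝ) :
    l1norm (shift (j • v) f - f) ≤ j * l1norm (shift v f - f) := by
  induction j with
  | zero => simp [shift_zero, l1norm_zero]
  | succ j ih =>
    refine (l1norm_sub_le_sub_add_sub (shift (j • v) f)).trans ?_
    rw [succ_nsmul, ← shift_shift, ← shift_sub, l1norm_shift, Nat.cast_succ, add_mul, one_mul,
      add_comm]
    gcongr

lemma l1norm_lineAvg_sub_self_le {k : ℕ} (hk : k ≠ 0) (v : G) (f : G → ℝ) :
    l1norm (lineAvg k v f - f) ≤ (k - 1 : ℕ) * l1norm (shift v f - f) := by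
  have e : lineAvg k v f - f
      = (k : ℝ)⁻¹ • ∑ j ∈ Finset.range k, (shift (j • v) f - f) := by
    have hk' : (k : ℝ) ≠ 0 := by exact_mod_cast hk
    rw [Finset.sum_sub_distrib, smul_sub, lineAvg]
    simp only [Finset.sum_const, Finset.card_range, ← Nat.cast_smul_eq_nsmul ℝ, smul_smul]
    rw [inv_mul_cancel₀ hk', one_smul]
  rw [e, l1norm_smul]
  calc _ ≤ ‖(k : ℝ)⁻¹‖ₑ *
        ∑ j ∈ Finset.range k, ((k - 1 : ℕ) : ℝ≥0∞) * l1norm (shift v f - f) := by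
        gcongr
        refine (l1norm_sum_le _ _).trans (Finset.sum_le_sum fun j hj => ?_)
        refine (l1norm_shift_nsmul_sub_self_le j v f).trans ?_
        gcongr
        have := Finset.mem_range.1 hj
        omega
    _ = _ := by
        simp only [Finset.sum_const, Finset.card_range, nsmul_eq_mul]
        rw [← mul_assoc, inv_natCast_mul_self hk, one_mul]

lemma l1norm_boxAvg_sub_self_le {k : ℕ} (hk : k ≠ 0) (L : List G) (f : G → ℝ) (V : ℝ≥0∞)
    (hV : ∀ v ∈ L, l1norm (shift v f - f) ≤ V) :
    l1norm (boxAvg k L f - f) ≤ L.length * ((k - 1 : ℕ) * V) := by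
  induction L with
  | nil => simp [boxAvg, l1norm_zero]
  | cons v L ih =>
    change l1norm (lineAvg k v (boxAvg k L f) - f) ≤ _
    refine (l1norm_sub_le_sub_add_sub (lineAvg k v f)).trans ?_
    rw [← lineAvg_sub, List.length_cons, Nat.cast_succ, add_mul, one_mul]
    refine add_le_add ((l1norm_lineAvg_le hk v _).trans
      (ih fun w hw => hV w (List.mem_cons_of_mem _ hw))) ?_
    refine (l1norm_lineAvg_sub_self_le hk v f).trans ?_
    gcongr
    exact hV v List.mem_cons_self

lemma l1norm_shift_lineAvg_sub_le (k : ℕ) (v : G) (f : G → ℝ) :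
    l1norm (shift v (lineAvg k v f) - lineAvg k v f) ≤ ‖(k : ℝ)⁻¹‖ₑ * (2 * l1norm f) := by
  have e : shift v (lineAvg k v f) - lineAvg k v f = (k : ℝ)⁻¹ • (shift (k • v) f - f) := by
    have h1 : shift v (lineAvg k v f)
        = (k : ℝ)⁻¹ • ∑ j ∈ Finset.range k, shift ((j + 1) • v) f := by
      rw [shift_lineAvg, lineAvg]
      simp_rw [shift_shift, succ_nsmul]
    rw [h1, lineAvg, ← smul_sub, ← Finset.sum_sub_distrib,
      Finset.sum_range_sub (fun j => shift (j • v) f), zero_nsmul, shift_zero]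
  rw [e, l1norm_smul]
  gcongr
  exact l1norm_shift_sub_self_le _ _

lemma l1norm_shift_boxAvg_sub_le {k : ℕ} (hk : k ≠ 0) (L : List G) (v : G) (hv : v ∈ L)
    (f : G → ℝ) :
    l1norm (shift v (boxAvg k L f) - boxAvg k L f) ≤ ‖(k : ℝ)⁻¹‖ₑ * (2 * l1norm f) := by
  induction L with
  | nil => simp at hv
  | cons w L ih =>
    change l1norm (shift v (lineAvg k w (boxAvg k L f)) - lineAvg k w (boxAvg k L f)) ≤ _
    rcases List.mem_cons.1 hv with rfl | hv
    · refine (l1norm_shift_lineAvg_sub_le k v _).trans ?_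
      gcongr
      exact l1norm_boxAvg_le hk L f
    · rw [shift_lineAvg, ← lineAvg_sub]
      exact (l1norm_lineAvg_le hk w _).trans (ih hv)

lemma abs_boxAvg_le {k : ℕ} (hk : k ≠ 0) (L : List G) {a : G → ℝ} {C : ℝ}
    (ha : ∀ κ, |a κ| ≤ C) (κ : G) : |boxAvg k L a κ| ≤ C := by
  induction L generalizing κ with
  | nil => exact ha κ
  | cons v L ih =>
    change |lineAvg k v (boxAvg k L a) κ| ≤ C
    have hk' : (0 : ℝ) < k := by exact_mod_cast Nat.pos_of_ne_zero hk
    simp only [lineAvg, Pi.smul_apply, Finset.sum_apply, smul_eq_mul, abs_mul, abs_inv,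
      Nat.abs_cast]
    rw [inv_mul_le_iff₀ hk']
    refine (Finset.abs_sum_le_sum_abs _ _).trans ?_
    refine (Finset.sum_le_sum fun j _ => ih (κ + j • v)).trans ?_
    simp

end Average

section Countable

variable {G : Type*} [Countable G] [MeasurableSpace G] [MeasurableSingletonClass G]

lemma integrable_of_abs_le {ν : Measure G} [IsFiniteMeasure ν] {f : G → ℝ} {C : ℝ}
    (h : ∀ κ, |f κ| ≤ C) : Integrable f ν :=
  Integrable.of_bound (Measurable.of_discrete).aestronglyMeasurable C (ae_of_all _ h)

lemma l1norm_integral_le {ι : Type*} [Countable ι] (ν : Measure G) (F : G → ι → ℝ) :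
    l1norm (fun α => ∫ κ, F κ α ∂ν) ≤ ∫⁻ κ, l1norm (F κ) ∂ν := by
  unfold l1norm
  rw [lintegral_tsum fun _ => Measurable.of_discrete.aemeasurable]
  exact ENNReal.tsum_le_tsum fun α => enorm_integral_le_lintegral_enorm _

end Countable

section JumpGen

variable {G : Type*} [AddCommGroup G] [MeasurableSpace G]

lemma shift_jumpGen (ν : Measure G) (v : G) (a : G → ℝ) :
    shift v (jumpGen ν a) = jumpGen ν (shift v a) := by
  funext α
  simp [shift, jumpGen, add_right_comm]

lemma jumpGen_smul (ν : Measure G) (c : ℝ) (a : G → ℝ) :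
    jumpGen ν (c • a) = c • jumpGen ν a := by
  funext α
  simp only [jumpGen, Pi.smul_apply, smul_eq_mul]
  rw [← integral_const_mul]
  exact integral_congr_ae (ae_of_all _ fun κ => by ring)

variable [Countable G] [MeasurableSingletonClass G]

lemma integrable_jump (ν : Measure G) [IsFiniteMeasure ν] {a : G → ℝ} {C : ℝ}
    (h : ∀ κ, |a κ| ≤ C) (α : G) : Integrable (fun κ => a (α + κ) - a α) ν :=
  integrable_of_abs_le (C := C + C) fun _ => (abs_sub _ _).trans (add_le_add (h _) (h _))

lemma l1norm_jumpGen_le (ν : Measure G) (a : G → ℝ) :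
    l1norm (jumpGen ν a) ≤ ∫⁻ κ, l1norm (shift κ a - a) ∂ν :=
  l1norm_integral_le ν fun κ => shift κ a - a

lemma l1norm_jumpGen_le_two_mul (ν : Measure G) (a : G → ℝ) :
    l1norm (jumpGen ν a) ≤ 2 * l1norm a * ν univ := by
  refine (l1norm_jumpGen_le ν a).trans ?_
  rw [← lintegral_const]
  exact lintegral_mono fun κ => l1norm_shift_sub_self_le κ a

lemma jumpGen_sub (ν : Measure G) [IsFiniteMeasure ν] {a b : G → ℝ} {C C' : ℝ}
    (ha : ∀ κ, |a κ| ≤ C) (hb : ∀ κ, |b κ| ≤ C') :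
    jumpGen ν (a - b) = jumpGen ν a - jumpGen ν b := by
  funext α
  simp only [jumpGen, Pi.sub_apply]
  rw [← integral_sub (integrable_jump ν ha α) (integrable_jump ν hb α)]
  exact integral_congr_ae (ae_of_all _ fun κ => by ring)

lemma jumpGen_lineAvg (ν : Measure G) [IsFiniteMeasure ν] (k : ℕ) (v : G) {a : G → ℝ} {C : ℝ}
    (ha : ∀ κ, |a κ| ≤ C) : jumpGen ν (lineAvg k v a) = lineAvg k v (jumpGen ν a) := by
  unfold lineAvg
  rw [jumpGen_smul]
  congr 1
  simp_rw [shift_jumpGen]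
  funext α
  simp only [jumpGen, Finset.sum_apply]
  rw [← integral_finsetSum _ fun j _ => integrable_jump ν (a := shift (j • v) a)
    (fun κ => ha (κ + j • v)) α]
  exact integral_congr_ae (ae_of_all _ fun κ => by simp [Finset.sum_sub_distrib])

lemma jumpGen_boxAvg (ν : Measure G) [IsFiniteMeasure ν] {k : ℕ} (hk : k ≠ 0) (L : List G)
    {a : G → ℝ} {C : ℝ} (ha : ∀ κ, |a κ| ≤ C) :
    jumpGen ν (boxAvg k L a) = boxAvg k L (jumpGen ν a) := by
  induction L with
  | nil => rfl
  | cons v L ih =>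
    change jumpGen ν (lineAvg k v (boxAvg k L a)) = lineAvg k v (boxAvg k L (jumpGen ν a))
    rw [jumpGen_lineAvg ν k v (abs_boxAvg_le hk L ha), ih]

/-- The `ℓ¹` contraction property of one step of the implicit scheme. -/
lemma l1norm_sub_le_of_implicit_step (ν : Measure G) [IsFiniteMeasure ν] {A : ℝ → ℝ}
    (hA : Monotone A) {dt : ℝ} (hdt : 0 ≤ dt) {u v h k : G → ℝ}
    (hAu : l1norm (A ∘ u) ≠ ⊤) (hAv : l1norm (A ∘ v) ≠ ⊤)
    (hu : u = h + dt • jumpGen ν (A ∘ u)) (hv : v = k + dt • jumpGen ν (A ∘ v)) :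
    l1norm (u - v) ≤ l1norm (h - k) := by
  set a : G → ℝ := A ∘ u - A ∘ v with ha_def
  have ha_top : l1norm a ≠ ⊤ :=
    ne_top_of_le_ne_top (ENNReal.add_ne_top.2 ⟨hAu, hAv⟩) (l1norm_sub_le _ _)
  have hab := abs_le_toReal_l1norm ha_top
  have hw : u - v = (h - k) + dt • jumpGen ν a := by
    rw [ha_def, jumpGen_sub ν (abs_le_toReal_l1norm hAu) (abs_le_toReal_l1norm hAv), smul_sub]
    nth_rw 1 [hu, hv]
    abel
  have hgen : ∀ α, jumpGen ν a α = ∫ κ, a (α + κ) ∂ν - ν.real univ * a α := by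
    intro α
    unfold jumpGen
    rw [integral_sub (integrable_of_abs_le fun κ => hab _) (integrable_const _), integral_const]
    simp
  have hsign : ∀ α, 0 ≤ (u - v) α * a α := by
    intro α
    simp only [ha_def, Pi.sub_apply, Function.comp_apply]
    rcases le_total (u α) (v α) with hle | hle
    · exact mul_nonneg_of_nonpos_of_nonpos (sub_nonpos.2 hle) (sub_nonpos.2 (hA hle))
    · exact mul_nonneg (sub_nonneg.2 hle) (sub_nonneg.2 (hA hle))
  have hm : 0 ≤ dt * ν.real univ := mul_nonneg hdt measureReal_nonneg
  have key : ∀ α, ‖(u - v) α‖ₑ + ‖dt * ν.real univ‖ₑ * ‖a α‖ₑ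
      ≤ ‖(h - k) α‖ₑ + ‖dt‖ₑ * ∫⁻ κ, ‖a (α + κ)‖ₑ ∂ν := by
    intro α
    have e : (u - v) α + dt * ν.real univ * a α = (h - k) α + dt * ∫ κ, a (α + κ) ∂ν := by
      rw [hw, Pi.add_apply, Pi.smul_apply, hgen, smul_eq_mul]
      ring
    have h1 : ‖(u - v) α‖ₑ + ‖dt * ν.real univ‖ₑ * ‖a α‖ₑ
        = ‖(u - v) α + dt * ν.real univ * a α‖ₑ := by
      rw [← enorm_mul, Real.enorm_eq_ofReal_abs, Real.enorm_eq_ofReal_abs,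
        Real.enorm_eq_ofReal_abs, ← ENNReal.ofReal_add (abs_nonneg _) (abs_nonneg _),
        (abs_add_eq_add_abs_iff _ _).2]
      refine mul_nonneg_iff.1 ?_
      rw [mul_left_comm]
      exact mul_nonneg hm (hsign α)
    rw [h1, e]
    refine (enorm_add_le _ _).trans ?_
    rw [enorm_mul]
    gcongr
    exact enorm_integral_le_lintegral_enorm _
  have hsum := ENNReal.tsum_le_tsum key
  rw [ENNReal.tsum_add, ENNReal.tsum_add, ENNReal.tsum_mul_left, ENNReal.tsum_mul_left,
    ← lintegral_tsum fun _ => Measurable.of_discrete.aemeasurable] at hsum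
  have e2 : ∫⁻ κ, ∑' α, ‖a (α + κ)‖ₑ ∂ν = l1norm a * ν univ := by
    rw [← lintegral_const]
    exact lintegral_congr fun κ => l1norm_shift κ a
  have e3 : ‖dt * ν.real univ‖ₑ * l1norm a = ‖dt‖ₑ * (l1norm a * ν univ) := by
    rw [enorm_mul, Real.enorm_of_nonneg measureReal_nonneg, ofReal_measureReal]
    ring
  change l1norm (u - v) + ‖dt * ν.real univ‖ₑ * l1norm a ≤ l1norm (h - k) + _ at hsum
  rw [e2, e3] at hsum
  exact (ENNReal.add_le_add_iff_right
    (ENNReal.mul_ne_top enorm_ne_top (ENNReal.mul_ne_top ha_top (measure_ne_top _ _)))).1 hsum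

end JumpGen

section LatticeGenerator

variable {d : ℕ}

/-- A lattice jump measure with an additional nearest-neighbour drift part. -/
def driftMeasure (ν : Measure (Fin d → ℤ)) (s : Fin d → ℤ) (c : Fin d → ℝ) :
    Measure (Fin d → ℤ) :=
  ν + ∑ l, ENNReal.ofReal (c l) • Measure.dirac (Pi.single l (s l))

instance (ν : Measure (Fin d → ℤ)) [IsFiniteMeasure ν] (s : Fin d → ℤ) (c : Fin d → ℝ) :
    IsFiniteMeasure (driftMeasure ν s c) := by
  refine ⟨?_⟩
  simp only [driftMeasure, Measure.add_apply, Measure.finsetSum_apply, Measure.smul_apply,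
    measure_univ, smul_eq_mul, mul_one]
  exact ENNReal.add_lt_top.2 ⟨measure_lt_top _ _,
    ENNReal.sum_lt_top.2 fun _ _ => ENNReal.ofReal_lt_top⟩

lemma integral_driftMeasure (ν : Measure (Fin d → ℤ)) [IsFiniteMeasure ν] (s : Fin d → ℤ)
    {c : Fin d → ℝ} (hc : ∀ l, 0 ≤ c l) {f : (Fin d → ℤ) → ℝ} {C : ℝ} (hf : ∀ κ, |f κ| ≤ C) :
    ∫ κ, f κ ∂(driftMeasure ν s c) = ∫ κ, f κ ∂ν + ∑ l, c l * f (Pi.single l (s l)) := by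
  have hint : ∀ l ∈ Finset.univ, Integrable f
      (ENNReal.ofReal (c l) • Measure.dirac (Pi.single l (s l) : Fin d → ℤ)) := fun l _ =>
    (integrable_of_abs_le hf).smul_measure ENNReal.ofReal_ne_top
  unfold driftMeasure
  rw [integral_add_measure (integrable_of_abs_le hf) (integrable_finsetSum_measure.2 hint),
    integral_finsetSum_measure hint]
  congr 1
  refine Finset.sum_congr rfl fun l _ => ?_
  rw [integral_smul_measure, integral_dirac, ENNReal.toReal_ofReal (hc l), smul_eq_mul]

lemma l1norm_jumpGen_driftMeasure_le (ν₁ ν₂ : Measure (Fin d → ℤ)) {s : Fin d → ℤ}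
    (hs : ∀ l, s l = 1 ∨ s l = -1) (c : Fin d → ℝ) {a : (Fin d → ℤ) → ℝ} {V : ℝ≥0∞}
    (hV : ∀ l, l1norm (shift (Pi.single l 1) a - a) ≤ V) :
    l1norm (jumpGen (driftMeasure (ν₁ + ν₂) s c) a) ≤
      2 * l1norm a * ν₂ univ + (∫⁻ κ, latticeLen κ ∂ν₁ + ∑ l, ENNReal.ofReal (c l)) * V := by
  refine (l1norm_jumpGen_le _ a).trans ?_
  simp only [driftMeasure, lintegral_add_measure, lintegral_finsetSum_measure,
    lintegral_smul_measure, lintegral_dirac, smul_eq_mul]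
  have h1 : ∫⁻ κ, l1norm (shift κ a - a) ∂ν₁ ≤ (∫⁻ κ, latticeLen κ ∂ν₁) * V := by
    rw [← lintegral_mul_const _ Measurable.of_discrete]
    exact lintegral_mono fun κ => l1norm_shift_sub_self_le_latticeLen a V hV κ
  have h2 : ∫⁻ κ, l1norm (shift κ a - a) ∂ν₂ ≤ 2 * l1norm a * ν₂ univ := by
    rw [← lintegral_const]
    exact lintegral_mono fun κ => l1norm_shift_sub_self_le κ a
  have h3 : ∑ l, ENNReal.ofReal (c l) * l1norm (shift (Pi.single l (s l)) a - a)
      ≤ (∑ l, ENNReal.ofReal (c l)) * V := by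
    rw [Finset.sum_mul]
    gcongr with l
    rcases hs l with h | h
    · rw [h]; exact hV l
    · rw [h, Pi.single_neg, l1norm_shift_neg_sub_self]; exact hV l
  rw [add_mul]
  calc _ ≤ (∫⁻ κ, latticeLen κ ∂ν₁) * V + 2 * l1norm a * ν₂ univ
        + (∑ l, ENNReal.ofReal (c l)) * V := by gcongr
    _ = _ := by ring

/-- The first-order Taylor remainder with forward or backward differences according to `s`. -/
def upwindRem (s : Fin d → ℤ) (f : (Fin d → ℤ) → ℝ) (κ : Fin d → ℤ) : (Fin d → ℤ) → ℝ :=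
  shift κ f - f - ∑ l, (κ l : ℝ) • (s l : ℝ) • (shift (Pi.single l (s l)) f - f)

lemma l1norm_upwindRem_le {s : Fin d → ℤ} (hs : ∀ l, s l = 1 ∨ s l = -1)
    (f : (Fin d → ℤ) → ℝ) (S : ℝ≥0∞)
    (hS : ∀ l m, l1norm (shift (Pi.single m 1) (shift (Pi.single l 1) f - f)
      - (shift (Pi.single l 1) f - f)) ≤ S) (κ : Fin d → ℤ) :
    l1norm (upwindRem s f κ) ≤ (latticeLen κ) ^ 2 * (2 * S) := by
  have e : upwindRem s f κ = taylorRem f κ - ∑ l, (κ l : ℝ) •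
      ((s l : ℝ) • (shift (Pi.single l (s l)) f - f) - (shift (Pi.single l 1) f - f)) := by
    simp only [upwindRem, taylorRem, smul_sub, Finset.sum_sub_distrib]
    abel
  have hcorr : ∀ l, l1norm
      ((s l : ℝ) • (shift (Pi.single l (s l)) f - f) - (shift (Pi.single l 1) f - f)) ≤ S := by
    intro l
    rcases hs l with h | h
    · rw [h]; simp [l1norm_zero]
    · rw [h]
      have e2 : ((-1 : ℤ) : ℝ) • (shift (Pi.single l (-1)) f - f) - (shift (Pi.single l 1) f - f)
          = shift (-Pi.single l 1) (shift (Pi.single l 1) f - f)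
            - (shift (Pi.single l 1) f - f) := by
        rw [shift_sub, shift_shift, neg_add_cancel, shift_zero, Pi.single_neg]
        simp
      rw [e2, l1norm_shift_neg_sub_self]
      exact hS l l
  have hsum : l1norm (∑ l, (κ l : ℝ) • ((s l : ℝ) • (shift (Pi.single l (s l)) f - f)
      - (shift (Pi.single l 1) f - f))) ≤ latticeLen κ * S := by
    refine (l1norm_sum_le _ _).trans ?_
    unfold latticeLen
    rw [Nat.cast_sum, Finset.sum_mul]
    gcongr with l
    rw [l1norm_smul]
    gcongr
    · rw [Real.enorm_eq_ofReal_abs, ← Int.cast_abs, Int.abs_eq_natAbs, Int.cast_natCast,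
        ENNReal.ofReal_natCast]
    · exact hcorr l
  rw [e]
  refine ((l1norm_sub_le _ _).trans (add_le_add (l1norm_taylorRem_le f S hS κ) hsum)).trans ?_
  rw [← add_mul, mul_left_comm, ← mul_assoc]
  gcongr
  norm_cast
  nlinarith [Nat.le_self_pow two_ne_zero (latticeLen κ)]

lemma l1norm_jumpGen_driftMeasure_le_of_centered (ν₁ ν₂ : Measure (Fin d → ℤ))
    [IsFiniteMeasure ν₁] [IsFiniteMeasure ν₂] {s : Fin d → ℤ} (hs : ∀ l, s l = 1 ∨ s l = -1)
    {c : Fin d → ℝ} (hc : ∀ l, 0 ≤ c l) (hint : ∀ l, Integrable (fun κ => (κ l : ℝ)) ν₁)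
    (hcs : ∀ l, c l = -(s l * ∫ κ, (κ l : ℝ) ∂ν₁)) {f : (Fin d → ℤ) → ℝ} {C : ℝ}
    (hf : ∀ κ, |f κ| ≤ C) {S : ℝ≥0∞}
    (hS : ∀ l m, l1norm (shift (Pi.single m 1) (shift (Pi.single l 1) f - f)
      - (shift (Pi.single l 1) f - f)) ≤ S) :
    l1norm (jumpGen (driftMeasure (ν₁ + ν₂) s c) f) ≤
      2 * l1norm f * ν₂ univ + (∫⁻ κ, (latticeLen κ : ℝ≥0∞) ^ 2 ∂ν₁) * (2 * S) := by
  have e : jumpGen (driftMeasure (ν₁ + ν₂) s c) f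
      = jumpGen ν₂ f + fun α => ∫ κ, upwindRem s f κ α ∂ν₁ := by
    funext α
    have hb : ∀ κ, |f (α + κ) - f α| ≤ C + C := fun κ =>
      (abs_sub _ _).trans (add_le_add (hf _) (hf _))
    simp only [jumpGen, Pi.add_apply]
    rw [integral_driftMeasure (ν₁ + ν₂) s hc hb,
      integral_add_measure (integrable_of_abs_le hb) (integrable_of_abs_le hb)]
    simp only [upwindRem, Pi.sub_apply, Finset.sum_apply, Pi.smul_apply, smul_eq_mul, shift]
    rw [integral_sub (integrable_of_abs_le hb)
      (integrable_finsetSum _ fun l _ => (hint l).mul_const _),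
      integral_finsetSum _ fun l _ => (hint l).mul_const _]
    simp_rw [integral_mul_const, hcs]
    have : ∑ l, -((s l : ℝ) * ∫ κ, (κ l : ℝ) ∂ν₁) * (f (α + Pi.single l (s l)) - f α)
        = -∑ l, (∫ κ, (κ l : ℝ) ∂ν₁) * ((s l : ℝ) * (f (α + Pi.single l (s l)) - f α)) := by
      rw [← Finset.sum_neg_distrib]
      exact Finset.sum_congr rfl fun l _ => by ring
    rw [this]
    ring
  rw [e]
  refine (l1norm_add_le _ _).trans (add_le_add (l1norm_jumpGen_le_two_mul ν₂ f) ?_)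
  refine (l1norm_integral_le ν₁ _).trans ?_
  rw [← lintegral_mul_const _ Measurable.of_discrete]
  exact lintegral_mono fun κ => l1norm_upwindRem_le hs f S hS κ

end LatticeGenerator

section ImplicitScheme

variable {G : Type*} [AddCommGroup G] [Countable G] [MeasurableSpace G] [MeasurableSingletonClass G]
  {ν : Measure G} [IsFiniteMeasure ν] {A : ℝ → ℝ} {dt L : ℝ} {u : ℕ → G → ℝ}

lemma l1norm_comp_sub_comp_le (hL : ∀ a b, |A a - A b| ≤ L * |a - b|) {ι : Type*} (f g : ι → ℝ) :
    l1norm (A ∘ f - A ∘ g) ≤ ENNReal.ofReal L * l1norm (f - g) := by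
  have hL0 : 0 ≤ L := by simpa using (abs_nonneg _).trans (hL 1 0)
  refine l1norm_le_l1norm _ fun i => ?_
  rw [Real.enorm_eq_ofReal_abs, Real.enorm_eq_ofReal_abs, ← ENNReal.ofReal_mul hL0]
  exact ENNReal.ofReal_le_ofReal (hL _ _)

lemma l1norm_comp_le (hL : ∀ a b, |A a - A b| ≤ L * |a - b|) (h0 : A 0 = 0) {ι : Type*}
    (f : ι → ℝ) : l1norm (A ∘ f) ≤ ENNReal.ofReal L * l1norm f := by
  have := l1norm_comp_sub_comp_le hL f 0
  have e : A ∘ (0 : ι → ℝ) = 0 := by funext i; exact h0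
  rwa [e, sub_zero, sub_zero] at this

lemma l1norm_comp_ne_top (hL : ∀ a b, |A a - A b| ≤ L * |a - b|) (h0 : A 0 = 0) {ι : Type*}
    {f : ι → ℝ} (hf : l1norm f ≠ ⊤) : l1norm (A ∘ f) ≠ ⊤ :=
  ne_top_of_le_ne_top (ENNReal.mul_ne_top ENNReal.ofReal_ne_top hf) (l1norm_comp_le hL h0 f)

lemma l1norm_implicitScheme_le (hA : Monotone A) (hL : ∀ a b, |A a - A b| ≤ L * |a - b|)
    (h0 : A 0 = 0) (hdt : 0 ≤ dt) (hfin : ∀ n, l1norm (u n) ≠ ⊤)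
    (hu : ∀ n, u (n + 1) = u n + dt • jumpGen ν (A ∘ u (n + 1))) (n : ℕ) :
    l1norm (u n) ≤ l1norm (u 0) := by
  induction n with
  | zero => rfl
  | succ n ih =>
    refine le_trans ?_ ih
    have hz : A ∘ (0 : G → ℝ) = 0 := by funext i; exact h0
    have := l1norm_sub_le_of_implicit_step ν hA hdt (l1norm_comp_ne_top hL h0 (hfin (n + 1)))
      (v := 0) (k := 0) (by simp [hz, l1norm_zero]) (hu n) (by
        funext α
        simp [jumpGen, h0])
    simpa using this

lemma l1norm_shift_implicitScheme_sub_le (hA : Monotone A) (hL : ∀ a b, |A a - A b| ≤ L * |a - b|)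
    (h0 : A 0 = 0) (hdt : 0 ≤ dt) (hfin : ∀ n, l1norm (u n) ≠ ⊤)
    (hu : ∀ n, u (n + 1) = u n + dt • jumpGen ν (A ∘ u (n + 1))) (v : G) (n : ℕ) :
    l1norm (shift v (u n) - u n) ≤ l1norm (shift v (u 0) - u 0) := by
  induction n with
  | zero => rfl
  | succ n ih =>
    refine le_trans ?_ ih
    have hfin' := l1norm_comp_ne_top hL h0 (hfin (n + 1))
    refine l1norm_sub_le_of_implicit_step ν hA hdt (u := shift v (u (n + 1))) ?_ hfin' ?_ (hu n)
    · have := l1norm_shift v (A ∘ u (n + 1))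
      exact this.trans_ne hfin'
    · change _ = shift v (u n) + dt • jumpGen ν (shift v (A ∘ u (n + 1)))
      rw [← shift_jumpGen]
      nth_rw 1 [hu n]
      rfl

lemma l1norm_implicitScheme_sub_le {G : Type*} [AddCommGroup G] [MeasurableSpace G]
    {ν : Measure G} {A : ℝ → ℝ} {dt : ℝ} {u : ℕ → G → ℝ} (hdt : 0 ≤ dt)
    (hu : ∀ n, u (n + 1) = u n + dt • jumpGen ν (A ∘ u (n + 1))) (P : (G → ℝ) → (G → ℝ))
    (hP : ∀ f g, P (f - g) = P f - P g) (K : ℝ≥0∞)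
    (hK : ∀ n, l1norm (P (dt • jumpGen ν (A ∘ u (n + 1)))) ≤ ENNReal.ofReal dt * K)
    (m j : ℕ) :
    l1norm (P (u (m + j)) - P (u m)) ≤ ENNReal.ofReal (j * dt) * K := by
  induction j with
  | zero => simp [l1norm_zero]
  | succ j ih =>
    refine (l1norm_sub_le_sub_add_sub (P (u (m + j)))).trans ?_
    rw [Nat.cast_succ, add_mul, one_mul, ENNReal.ofReal_add (by positivity) hdt, add_mul, add_comm]
    refine add_le_add ih ?_
    have := hK (m + j)
    rwa [← sub_eq_of_eq_add' (hu (m + j)), hP] at this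

end ImplicitScheme

section LatticeScheme

variable {d : ℕ}

lemma l1norm_second_diff_boxAvg_le {k : ℕ} (hk : k ≠ 0) {a : (Fin d → ℤ) → ℝ} {V : ℝ≥0∞}
    (hV : ∀ l, l1norm (shift (Pi.single l 1) a - a) ≤ V) (L : List (Fin d → ℤ))
    (hL : ∀ l : Fin d, Pi.single l 1 ∈ L) (l m : Fin d) :
    l1norm (shift (Pi.single m 1) (shift (Pi.single l 1) (boxAvg k L a) - boxAvg k L a)
      - (shift (Pi.single l 1) (boxAvg k L a) - boxAvg k L a)) ≤ ‖(k : ℝ)⁻¹‖ₑ * (2 * V) := by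
  rw [shift_boxAvg k L (Pi.single l 1), ← boxAvg_sub]
  refine (l1norm_shift_boxAvg_sub_le hk L _ (hL m) _).trans ?_
  gcongr
  exact hV l

/-- Time regularity of the implicit scheme for a generator with an absolutely controlled drift. -/
lemma l1norm_implicitScheme_sub_le_of_drift {ν₁ ν₂ : Measure (Fin d → ℤ)}
    [IsFiniteMeasure ν₁] [IsFiniteMeasure ν₂] {s : Fin d → ℤ} (hs : ∀ l, s l = 1 ∨ s l = -1)
    {c : Fin d → ℝ} {A : ℝ → ℝ} {dt L : ℝ}
    {u : ℕ → (Fin d → ℤ) → ℝ} (hA : Monotone A) (hL : ∀ a b, |A a - A b| ≤ L * |a - b|)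
    (h0 : A 0 = 0) (hdt : 0 ≤ dt) (hfin : ∀ n, l1norm (u n) ≠ ⊤)
    (hu : ∀ n, u (n + 1) = u n + dt • jumpGen (driftMeasure (ν₁ + ν₂) s c) (A ∘ u (n + 1)))
    {V : ℝ≥0∞} (hV : ∀ l, l1norm (shift (Pi.single l 1) (u 0) - u 0) ≤ V) (m j : ℕ) :
    l1norm (u (m + j) - u m) ≤ ENNReal.ofReal (j * dt) *
      (2 * (ENNReal.ofReal L * l1norm (u 0)) * ν₂ univ +
        (∫⁻ κ, latticeLen κ ∂ν₁ + ∑ l, ENNReal.ofReal (c l)) * (ENNReal.ofReal L * V)) := by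
  refine l1norm_implicitScheme_sub_le hdt hu id (fun _ _ => rfl) _ (fun n => ?_) m j
  rw [id, l1norm_smul, Real.enorm_of_nonneg hdt]
  gcongr
  refine (l1norm_jumpGen_driftMeasure_le ν₁ ν₂ hs c (V := ENNReal.ofReal L * V)
    fun l => ?_).trans ?_
  · refine (l1norm_comp_sub_comp_le hL (shift (Pi.single l 1) (u (n + 1))) (u (n + 1))).trans ?_
    gcongr
    exact (l1norm_shift_implicitScheme_sub_le hA hL h0 hdt hfin hu _ _).trans (hV l)
  · gcongr
    refine (l1norm_comp_le hL h0 _).trans ?_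
    gcongr
    exact l1norm_implicitScheme_le hA hL h0 hdt hfin hu _

/-- Time regularity of the implicit scheme at the averaging scale `k`, for a generator whose drift
compensates the first moment of the jump measure. -/
lemma l1norm_implicitScheme_sub_le_of_centered {ν₁ ν₂ : Measure (Fin d → ℤ)}
    [IsFiniteMeasure ν₁] [IsFiniteMeasure ν₂] {s : Fin d → ℤ} (hs : ∀ l, s l = 1 ∨ s l = -1)
    {c : Fin d → ℝ} (hc : ∀ l, 0 ≤ c l) (hint : ∀ l, Integrable (fun κ => (κ l : ℝ)) ν₁)
    (hcs : ∀ l, c l = -(s l * ∫ κ, (κ l : ℝ) ∂ν₁)) {A : ℝ → ℝ} {dt L : ℝ}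
    {u : ℕ → (Fin d → ℤ) → ℝ} (hA : Monotone A) (hL : ∀ a b, |A a - A b| ≤ L * |a - b|)
    (h0 : A 0 = 0) (hdt : 0 ≤ dt) (hfin : ∀ n, l1norm (u n) ≠ ⊤)
    (hu : ∀ n, u (n + 1) = u n + dt • jumpGen (driftMeasure (ν₁ + ν₂) s c) (A ∘ u (n + 1)))
    {V : ℝ≥0∞} (hV : ∀ l, l1norm (shift (Pi.single l 1) (u 0) - u 0) ≤ V)
    {k : ℕ} (hk : k ≠ 0) (m j : ℕ) :
    l1norm (u (m + j) - u m) ≤ 2 * (d * ((k - 1 : ℕ) * V)) + ENNReal.ofReal (j * dt) *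
      (2 * (ENNReal.ofReal L * l1norm (u 0)) * ν₂ univ +
        (∫⁻ κ, (latticeLen κ : ℝ≥0∞) ^ 2 ∂ν₁) *
          (2 * (‖(k : ℝ)⁻¹‖ₑ * (2 * (ENNReal.ofReal L * V))))) := by
  set Λ : List (Fin d → ℤ) := (List.finRange d).map fun l => Pi.single l 1 with hΛ
  have hmem : ∀ l : Fin d, (Pi.single l 1 : Fin d → ℤ) ∈ Λ := fun l =>
    List.mem_map.2 ⟨l, List.mem_finRange l, rfl⟩
  have hVn : ∀ n l, l1norm (shift (Pi.single l 1) (u n) - u n) ≤ V := fun n l =>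
    (l1norm_shift_implicitScheme_sub_le hA hL h0 hdt hfin hu _ _).trans (hV l)
  have havg : ∀ n, l1norm (boxAvg k Λ (u n) - u n) ≤ d * ((k - 1 : ℕ) * V) := by
    intro n
    have := l1norm_boxAvg_sub_self_le hk Λ (u n) V fun v hv => by
      obtain ⟨l, -, rfl⟩ := List.mem_map.1 hv
      exact hVn n l
    simpa [hΛ] using this
  have htime := l1norm_implicitScheme_sub_le hdt hu (boxAvg k Λ) (boxAvg_sub k Λ)
    (2 * (ENNReal.ofReal L * l1norm (u 0)) * ν₂ univ +
        (∫⁻ κ, (latticeLen κ : ℝ≥0∞) ^ 2 ∂ν₁) *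
          (2 * (‖(k : ℝ)⁻¹‖ₑ * (2 * (ENNReal.ofReal L * V))))) (fun n => ?_) m j
  · have h1 := l1norm_sub_le_sub_add_sub (f := u (m + j)) (g := u m) (boxAvg k Λ (u (m + j)))
    have h2 := l1norm_sub_le_sub_add_sub (f := boxAvg k Λ (u (m + j))) (g := u m)
      (boxAvg k Λ (u m))
    rw [l1norm_sub_comm _ (boxAvg k Λ (u (m + j)))] at h1
    refine (h1.trans (add_le_add (havg _) (h2.trans (add_le_add htime (havg m))))).trans_eq ?_
    rw [two_mul (_ * (_ * V))]
    abel
  · have hbound := abs_le_toReal_l1norm (l1norm_comp_ne_top hL h0 (hfin (n + 1)))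
    rw [boxAvg_smul, ← jumpGen_boxAvg _ hk Λ hbound, l1norm_smul, Real.enorm_of_nonneg hdt]
    gcongr
    refine (l1norm_jumpGen_driftMeasure_le_of_centered ν₁ ν₂ hs hc hint hcs
      (abs_boxAvg_le hk Λ hbound)
      (l1norm_second_diff_boxAvg_le hk (V := ENNReal.ofReal L * V) (fun l => ?_) Λ hmem)).trans ?_
    · refine (l1norm_comp_sub_comp_le hL (shift (Pi.single l 1) (u (n + 1))) (u (n + 1))).trans ?_
      gcongr
      exact hVn _ _
    · gcongr
      refine (l1norm_boxAvg_le hk _ _).trans ((l1norm_comp_le hL h0 _).trans ?_)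
      gcongr
      exact l1norm_implicitScheme_le hA hL h0 hdt hfin hu _

end LatticeScheme

section Cells

variable {d : ℕ}

lemma cell_eq_preimage (dx : ℝ) (α : Fin d → ℤ) :
    cell d dx α = WithLp.ofLp ⁻¹' univ.pi fun i => Ioo (dx * (α i : ℝ)) (dx * (α i : ℝ) + dx) := by
  ext x
  simp [cell, mem_pi]

lemma measurableSet_cell (dx : ℝ) (α : Fin d → ℤ) : MeasurableSet (cell d dx α) := by
  rw [cell_eq_preimage]
  exact (PiLp.volume_preserving_ofLp (Fin d)).measurable
    (MeasurableSet.univ_pi fun _ => measurableSet_Ioo)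

lemma volume_cell {dx : ℝ} (hdx : 0 ≤ dx) (α : Fin d → ℤ) :
    volume (cell d dx α) = ENNReal.ofReal (dx ^ d) := by
  rw [cell_eq_preimage, (PiLp.volume_preserving_ofLp (Fin d)).measure_preimage
    (MeasurableSet.univ_pi fun _ => measurableSet_Ioo).nullMeasurableSet, Real.volume_pi_Ioo]
  simp [ENNReal.ofReal_pow hdx]

lemma measurable_ind_cell (dx : ℝ) (α : Fin d → ℤ) : Measurable (ind d (cell d dx α)) :=
  measurable_const.indicator (measurableSet_cell dx α)

lemma abs_ind_le_one (S : Set (Ed d)) (x : Ed d) : |ind d S x| ≤ 1 := by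
  unfold ind
  by_cases h : x ∈ S <;> simp [h]

lemma eq_of_mem_cell {dx : ℝ} (hdx : 0 < dx) {α β : Fin d → ℤ} {x : Ed d}
    (hα : x ∈ cell d dx α) (hβ : x ∈ cell d dx β) : α = β := by
  funext i
  have h1 := hα i
  have h2 := hβ i
  have h3 : dx * (α i : ℝ) < dx * ((β i + 1 : ℤ) : ℝ) := by push_cast; linarith
  have h4 : dx * (β i : ℝ) < dx * ((α i + 1 : ℤ) : ℝ) := by push_cast; linarith
  have h5 := Int.cast_lt.1 (lt_of_mul_lt_mul_left h3 hdx.le)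
  have h6 := Int.cast_lt.1 (lt_of_mul_lt_mul_left h4 hdx.le)
  omega

lemma ind_cell_of_mem {dx : ℝ} (hdx : 0 < dx) {α : Fin d → ℤ} (β : Fin d → ℤ) {x : Ed d}
    (hα : x ∈ cell d dx α) : ind d (cell d dx β) x = if α = β then 1 else 0 := by
  unfold ind
  split_ifs with h
  · subst h; simp [hα]
  · exact indicator_of_notMem (fun hβ => h (eq_of_mem_cell hdx hα hβ)) _

lemma add_single_mem_cell {dx : ℝ} {α : Fin d → ℤ} (l : Fin d) (n : ℤ) {x : Ed d}
    (hx : x ∈ cell d dx α) :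
    x + EuclideanSpace.single l (n * dx) ∈ cell d dx (α + Pi.single l n) := by
  intro i
  have := hx i
  rcases eq_or_ne i l with rfl | h
  · simp only [PiLp.add_apply, PiLp.single_apply, Pi.add_apply, Pi.single_eq_same, if_true]
    push_cast
    constructor <;> linarith
  · simpa [PiLp.single_apply, h] using this

/-- The real vector with the given integer coordinates. -/
def latticePt (α : Fin d → ℤ) : Ed d := WithLp.toLp 2 fun i => (α i : ℝ)

lemma smul_add_latticePt_mem_cell {dx : ℝ} (hdx : 0 < dx) (α : Fin d → ℤ) (y : Ed d) :
    dx • (y + latticePt α) ∈ cell d dx α ↔ y ∈ cell d 1 0 := by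
  refine forall_congr' fun i => ?_
  simp only [PiLp.smul_apply, PiLp.add_apply, latticePt, smul_eq_mul, Pi.zero_apply, Int.cast_zero,
    mul_zero, zero_add]
  constructor
  · rintro ⟨h1, h2⟩
    exact ⟨by nlinarith, by nlinarith⟩
  · rintro ⟨h1, h2⟩
    exact ⟨by nlinarith, by nlinarith⟩

/-- The uniform probability measure on the open unit cube. -/
def cubeMeasure (d : ℕ) : Measure (Ed d) := volume.restrict (cell d 1 0)

instance : IsProbabilityMeasure (cubeMeasure d) :=
  ⟨by simp [cubeMeasure, volume_cell zero_le_one]⟩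

lemma setIntegral_cell {dx : ℝ} (hdx : 0 < dx) (α : Fin d → ℤ) (f : Ed d → ℝ) :
    (dx ^ d)⁻¹ * ∫ x in cell d dx α, f x = ∫ y, f (dx • (y + latticePt α)) ∂cubeMeasure d := by
  have h := Measure.integral_comp_smul (volume : Measure (Ed d)) ((cell d dx α).indicator f) dx
  rw [← integral_add_right_eq_self _ (latticePt α), integral_indicator (measurableSet_cell dx α),
    finrank_euclideanSpace_fin, abs_of_pos (by positivity), smul_eq_mul] at h
  rw [← h, cubeMeasure, ← integral_indicator (measurableSet_cell 1 0)]
  congr 1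
  funext y
  by_cases hy : y ∈ cell d 1 0
  · rw [indicator_of_mem hy, indicator_of_mem ((smul_add_latticePt_mem_cell hdx α y).2 hy)]
  · rw [indicator_of_notMem hy,
      indicator_of_notMem (mt (smul_add_latticePt_mem_cell hdx α y).1 hy)]

lemma cubeMeasure_map_eval (l : Fin d) :
    MeasurePreserving (fun y : Ed d => y l) (cubeMeasure d) (volume.restrict (Ioo 0 1)) := by
  have h1 : MeasurePreserving WithLp.ofLp (cubeMeasure d)
      (Measure.pi fun _ : Fin d => (volume : Measure ℝ).restrict (Ioo 0 1)) := by
    have := (PiLp.volume_preserving_ofLp (Fin d)).restrict_preimage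
      (s := univ.pi fun _ => Ioo (0 : ℝ) 1) (MeasurableSet.univ_pi fun _ => measurableSet_Ioo)
    rw [volume_pi, Measure.restrict_pi_pi] at this
    convert this using 1
    rw [cubeMeasure, cell_eq_preimage]
    simp
  have : IsProbabilityMeasure ((volume : Measure ℝ).restrict (Ioo 0 1)) := ⟨by simp⟩
  exact (measurePreserving_eval
    (fun _ : Fin d => (volume : Measure ℝ).restrict (Ioo 0 1)) l).comp h1

lemma integral_floor_add (t : ℝ) : ∫ y in Ioo (0 : ℝ) 1, (⌊y + t⌋ : ℝ) = t := by
  have hper : Function.Periodic (Int.fract : ℝ → ℝ) 1 := Int.fract_periodic ℝ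
  have hmeas : Measurable (Int.fract : ℝ → ℝ) := measurable_fract
  have hb : ∀ x : ℝ, ‖Int.fract x‖ ≤ 1 := fun x => by
    rw [Real.norm_of_nonneg (Int.fract_nonneg x)]
    exact (Int.fract_lt_one x).le
  have hfin : IsFiniteMeasure ((volume : Measure ℝ).restrict (Ioo 0 1)) := ⟨by simp⟩
  have h1 : ∫ y in Ioo (0 : ℝ) 1, Int.fract (y + t) = ∫ y in Ioo (0 : ℝ) 1, Int.fract y := by
    rw [← integral_Ioc_eq_integral_Ioo, ← integral_Ioc_eq_integral_Ioo,
      ← intervalIntegral.integral_of_le zero_le_one, ← intervalIntegral.integral_of_le zero_le_one,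
      intervalIntegral.integral_comp_add_right]
    have := hper.intervalIntegral_add_eq t 0
    simpa [add_comm] using this
  have h2 : ∫ y in Ioo (0 : ℝ) 1, Int.fract y = ∫ y in Ioo (0 : ℝ) 1, y :=
    setIntegral_congr_fun measurableSet_Ioo fun y hy =>
      Int.fract_eq_self.2 ⟨hy.1.le, hy.2⟩
  have hid : Integrable (fun y : ℝ => y) ((volume : Measure ℝ).restrict (Ioo 0 1)) :=
    (continuous_id.integrableOn_Icc (a := (0 : ℝ)) (b := 1)).mono_set Ioo_subset_Icc_self
  calc ∫ y in Ioo (0 : ℝ) 1, (⌊y + t⌋ : ℝ)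
      = ∫ y in Ioo (0 : ℝ) 1, (y + t - Int.fract (y + t)) := by
        simp only [Int.self_sub_fract]
    _ = t := by
        rw [integral_sub (f := fun y => y + t) (g := fun y => Int.fract (y + t))
          (hid.add (integrable_const t)) (Integrable.of_bound
          (hmeas.comp (measurable_id.add_const t)).aestronglyMeasurable 1
          (ae_of_all _ fun y => hb (y + t))), integral_add hid (integrable_const t), h1, h2]
        simp

/-- The number of cells by which a jump `z` displaces the point `dx • y` of the reference cell. -/
def cellIndex (dx : ℝ) (p : Ed d × Ed d) : Fin d → ℤ := fun i => ⌊p.1 i + p.2 i / dx⌋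

lemma measurable_cellIndex (dx : ℝ) : Measurable (cellIndex (d := d) dx) := by
  refine measurable_pi_lambda _ fun i => Int.measurable_floor.comp ?_
  fun_prop

/-- The lattice jump measure induced by the restriction of `μ` to `S`, averaging over the
starting point in the cell. -/
def cellJump (dx : ℝ) (μ : Measure (Ed d)) (S : Set (Ed d)) : Measure (Fin d → ℤ) :=
  ((cubeMeasure d).prod (μ.restrict S)).map (cellIndex dx)

instance (dx : ℝ) (μ : Measure (Ed d)) (S : Set (Ed d)) [IsFiniteMeasure (μ.restrict S)] :
    IsFiniteMeasure (cellJump dx μ S) := by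
  unfold cellJump; infer_instance

lemma cellJump_univ (dx : ℝ) (μ : Measure (Ed d)) (S : Set (Ed d))
    [IsFiniteMeasure (μ.restrict S)] : cellJump dx μ S univ = μ S := by
  rw [cellJump, Measure.map_apply (measurable_cellIndex dx) MeasurableSet.univ, preimage_univ,
    ← univ_prod_univ, Measure.prod_prod]
  simp

lemma ae_cell_interior (dx : ℝ) (ρ : Measure (Ed d)) [SFinite ρ] :
    ∀ᵐ p ∂(cubeMeasure d).prod ρ, ∀ i, ∀ n : ℤ, p.1 i + p.2 i / dx ≠ n := by
  rw [ae_all_iff]; intro i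
  rw [ae_all_iff]; intro n
  have hms : MeasurableSet {p : Ed d × Ed d | p.1 i + p.2 i / dx = n} :=
    measurableSet_eq_fun (by fun_prop) measurable_const
  have h0 : ((cubeMeasure d).prod ρ) {p : Ed d × Ed d | p.1 i + p.2 i / dx = n} = 0 := by
    rw [Measure.prod_apply_symm hms]
    refine (lintegral_congr fun z => ?_).trans lintegral_zero
    have e : ((fun x : Ed d => (x, z)) ⁻¹' {p : Ed d × Ed d | p.1 i + p.2 i / dx = n})
        = (fun y : Ed d => y i) ⁻¹' {(n : ℝ) - z i / dx} := by
      ext y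
      simp [eq_sub_iff_add_eq]
    rw [e, (cubeMeasure_map_eval i).measure_preimage
      (measurableSet_singleton _).nullMeasurableSet]
    simp
  exact measure_eq_zero_iff_ae_notMem.1 h0

lemma smul_add_mem_cell_iff {dx : ℝ} (hdx : 0 < dx) (α β : Fin d → ℤ) {p : Ed d × Ed d}
    (hp : ∀ i, ∀ n : ℤ, p.1 i + p.2 i / dx ≠ n) :
    dx • (p.1 + latticePt α) + p.2 ∈ cell d dx β ↔ cellIndex dx p = β - α := by
  rw [funext_iff]
  refine forall_congr' fun i => ?_
  simp only [PiLp.smul_apply, PiLp.add_apply, latticePt, smul_eq_mul, cellIndex, Pi.sub_apply,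
    Int.floor_eq_iff]
  have e : dx * (p.1 i + α i) + p.2 i = dx * (p.1 i + p.2 i / dx + α i) := by field_simp; ring
  have e2 : dx * (β i : ℝ) + dx = dx * (β i + 1) := by ring
  rw [e, e2, mul_lt_mul_iff_right₀ hdx, mul_lt_mul_iff_right₀ hdx]
  push_cast
  constructor
  · rintro ⟨h1, h2⟩
    constructor <;> linarith
  · rintro ⟨h1, h2⟩
    have := lt_of_le_of_ne h1 (by have := hp i (β i - α i); push_cast at this; exact this.symm)
    constructor <;> linarith

lemma cell_average_jump {dx : ℝ} (hdx : 0 < dx) (μ : Measure (Ed d)) (S : Set (Ed d))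
    [IsFiniteMeasure (μ.restrict S)] (α β : Fin d → ℤ) :
    (dx ^ d)⁻¹ * ∫ x in cell d dx α, ∫ z in S,
      (ind d (cell d dx β) (x + z) - ind d (cell d dx β) x) ∂μ =
    (cellJump dx μ S).real {β - α} - (cellJump dx μ S).real univ * if α = β then 1 else 0 := by
  rw [setIntegral_cell hdx]
  have hF : Integrable (fun p : Ed d × Ed d =>
      ind d (cell d dx β) (dx • (p.1 + latticePt α) + p.2))
      ((cubeMeasure d).prod (μ.restrict S)) :=
    Integrable.of_bound ((measurable_ind_cell dx β).comp (by fun_prop)).aestronglyMeasurable 1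
      (ae_of_all _ fun _ => abs_ind_le_one _ _)
  have h1 : ∫ p, ind d (cell d dx β) (dx • (p.1 + latticePt α) + p.2)
      ∂(cubeMeasure d).prod (μ.restrict S) = (cellJump dx μ S).real {β - α} := by
    rw [cellJump, map_measureReal_apply (measurable_cellIndex dx) (measurableSet_singleton _),
      ← integral_indicator_one ((measurable_cellIndex dx) (measurableSet_singleton _))]
    refine integral_congr_ae ?_
    filter_upwards [ae_cell_interior dx (μ.restrict S)] with p hp
    simp only [ind, indicator, smul_add_mem_cell_iff hdx α β hp, mem_preimage, mem_singleton_iff,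
      Pi.one_apply]
  rw [← h1, integral_prod _ hF, measureReal_def, cellJump_univ, ← measureReal_def]
  have h2 : ∀ᵐ y ∂cubeMeasure d, ∫ z in S, (ind d (cell d dx β) (dx • (y + latticePt α) + z)
      - ind d (cell d dx β) (dx • (y + latticePt α))) ∂μ =
      ∫ z in S, ind d (cell d dx β) (dx • (y + latticePt α) + z) ∂μ
        - μ.real S * if α = β then 1 else 0 := by
    filter_upwards [ae_restrict_mem (measurableSet_cell 1 0)] with y hy
    rw [integral_sub, ind_cell_of_mem hdx β ((smul_add_latticePt_mem_cell hdx α y).2 hy)]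
    · simp
    · exact Integrable.of_bound
        ((measurable_ind_cell dx β).comp (by fun_prop)).aestronglyMeasurable 1
        (ae_of_all _ fun _ => abs_ind_le_one _ _)
    · exact integrable_const _
  rw [integral_congr_ae h2, integral_sub hF.integral_prod_left (integrable_const _)]
  simp

end Cells

section Moments

variable {d : ℕ}

lemma latticeLen_cellIndex_le {dx : ℝ} (hdx : 0 < dx) {y z : Ed d} (hy : y ∈ cell d 1 0)
    (hz : dx / 2 < ‖z‖) : (latticeLen (cellIndex dx (y, z)) : ℝ) ≤ 3 * d * ‖z‖ / dx := by
  have h : ∀ i : Fin d, (((cellIndex dx (y, z) i).natAbs : ℕ) : ℝ) ≤ 3 * ‖z‖ / dx := by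
    intro i
    rw [Nat.cast_natAbs, Int.cast_abs, cellIndex, le_div_iff₀ hdx]
    have hyi := hy i
    simp only [Pi.zero_apply, Int.cast_zero, mul_zero, zero_add] at hyi
    have hzi := abs_le.1 ((Real.norm_eq_abs _).symm.trans_le (PiLp.norm_apply_le z i))
    have h1 := Int.floor_le (y i + z i / dx)
    have h2 := Int.lt_floor_add_one (y i + z i / dx)
    have e : z i = z i / dx * dx := by field_simp
    generalize (⌊y i + z i / dx⌋ : ℝ) = n at *
    generalize z i / dx = t at *
    rw [show |n| * dx = |n * dx| by rw [abs_mul, abs_of_pos hdx], abs_le]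
    constructor <;> nlinarith
  rw [latticeLen, Nat.cast_sum]
  refine (Finset.sum_le_sum fun i _ => h i).trans_eq ?_
  simp
  ring

lemma lintegral_latticeLen_pow_cellJump_le {dx : ℝ} (hdx : 0 < dx) (μ : Measure (Ed d))
    {S : Set (Ed d)} (hSdx : ∀ z ∈ S, dx / 2 < ‖z‖)
    [IsFiniteMeasure (μ.restrict S)] (n : ℕ) :
    ∫⁻ κ, (latticeLen κ : ℝ≥0∞) ^ n ∂cellJump dx μ S ≤
      ENNReal.ofReal ((3 * d / dx) ^ n) * ∫⁻ z in S, ENNReal.ofReal (‖z‖ ^ n) ∂μ := by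
  rw [cellJump, lintegral_map Measurable.of_discrete (measurable_cellIndex dx),
    lintegral_prod (fun p => (latticeLen (cellIndex dx p) : ℝ≥0∞) ^ n)
      ((Measurable.of_discrete (f := fun κ : Fin d → ℤ =>
        (latticeLen κ : ℝ≥0∞) ^ n)).comp (measurable_cellIndex dx)).aemeasurable,
    ← lintegral_const_mul _ (by fun_prop)]
  calc _ ≤ ∫⁻ _, ∫⁻ z in S, ENNReal.ofReal ((3 * d / dx) ^ n) * ENNReal.ofReal (‖z‖ ^ n) ∂μ
        ∂cubeMeasure d := by
        refine lintegral_mono_ae ?_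
        filter_upwards [ae_restrict_mem (measurableSet_cell 1 0)] with y hy
        refine setLIntegral_mono_ae (by fun_prop) (ae_of_all _ fun z hz => ?_)
        rw [← ENNReal.ofReal_mul (by positivity), ← mul_pow, div_mul_eq_mul_div,
          ← ENNReal.ofReal_natCast, ← ENNReal.ofReal_pow (by positivity)]
        exact ENNReal.ofReal_le_ofReal
          (pow_le_pow_left₀ (by positivity) (latticeLen_cellIndex_le hdx hy (hSdx z hz)) n)
    _ = _ := by simp

lemma integrable_coord_of_lintegral_latticeLen (ν : Measure (Fin d → ℤ))
    (h : ∫⁻ κ, latticeLen κ ∂ν ≠ ⊤) (l : Fin d) : Integrable (fun κ => (κ l : ℝ)) ν := by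
  refine ⟨Measurable.of_discrete.aestronglyMeasurable, lt_of_le_of_lt ?_ h.lt_top⟩
  refine lintegral_mono fun κ => ?_
  rw [Real.enorm_eq_ofReal_abs, ← Int.cast_abs, Int.abs_eq_natAbs, Int.cast_natCast,
    ENNReal.ofReal_natCast]
  refine Nat.cast_le.2 ?_
  exact Finset.single_le_sum (f := fun i => (κ i).natAbs) (fun _ _ => Nat.zero_le _)
    (Finset.mem_univ l)

lemma integral_coord_cellJump (dx : ℝ) (μ : Measure (Ed d)) (S : Set (Ed d))
    [IsFiniteMeasure (μ.restrict S)] (l : Fin d)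
    (hint : Integrable (fun κ => (κ l : ℝ)) (cellJump dx μ S)) :
    ∫ κ, (κ l : ℝ) ∂cellJump dx μ S = (∫ z in S, z l ∂μ) / dx := by
  have hmeas : AEStronglyMeasurable (fun κ : Fin d → ℤ => (κ l : ℝ)) (cellJump dx μ S) :=
    Measurable.of_discrete.aestronglyMeasurable
  have hint' := (integrable_map_measure hmeas (measurable_cellIndex dx).aemeasurable).1 hint
  rw [cellJump, integral_map (measurable_cellIndex dx).aemeasurable hmeas,
    integral_prod_symm (fun p => (cellIndex dx p l : ℝ)) hint', ← integral_div]
  refine integral_congr_ae (ae_of_all _ fun z => ?_)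
  have hm : Measurable fun t : ℝ => (⌊t + z l / dx⌋ : ℝ) := by fun_prop
  have := integral_map (μ := cubeMeasure d) (cubeMeasure_map_eval l).measurable.aemeasurable
    (f := fun t : ℝ => (⌊t + z l / dx⌋ : ℝ)) hm.aestronglyMeasurable
  rw [(cubeMeasure_map_eval l).map_eq, integral_floor_add] at this
  exact this.symm

end Moments

section Weights

variable {d : ℕ}

/-- The direction of the upwind difference in the `l`-th coordinate. -/
def upwindSign (dx : ℝ) (μ : Measure (Ed d)) (l : Fin d) : ℤ := if 0 < gam d dx μ l then 1 else -1

lemma upwindSign_eq (dx : ℝ) (μ : Measure (Ed d)) (l : Fin d) :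
    upwindSign dx μ l = 1 ∨ upwindSign dx μ l = -1 := by
  unfold upwindSign
  split_ifs <;> simp

lemma upwindSign_mul_gam (dx : ℝ) (μ : Measure (Ed d)) (l : Fin d) :
    upwindSign dx μ l * gam d dx μ l = |gam d dx μ l| := by
  unfold upwindSign
  split_ifs with h
  · simp [abs_of_pos h]
  · simp [abs_of_nonpos (not_lt.1 h)]

lemma gam_mul_Dup {dx : ℝ} (hdx : 0 < dx) (μ : Measure (Ed d)) (l : Fin d) {α : Fin d → ℤ}
    (β : Fin d → ℤ) {x : Ed d} (hx : x ∈ cell d dx α) :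
    gam d dx μ l * Dup d dx μ l (ind d (cell d dx β)) x = |gam d dx μ l| / dx *
      ((if α + Pi.single l (upwindSign dx μ l) = β then 1 else 0) - if α = β then 1 else 0) := by
  rw [← upwindSign_mul_gam, Dup, upwindSign]
  split_ifs with h
  all_goals
    have hp := ind_cell_of_mem hdx β (add_single_mem_cell l 1 hx)
    have hm := ind_cell_of_mem hdx β (add_single_mem_cell l (-1) hx)
    have h0 := ind_cell_of_mem hdx β hx
    simp only [Int.cast_neg, Int.cast_one, neg_mul, one_mul] at hp hm
    have e : x - EuclideanSpace.single l dx = x + EuclideanSpace.single l (-dx) := by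
      ext i
      by_cases hi : i = l <;> simp [hi, sub_eq_add_neg]
    simp_all
    try ring

lemma Gup_eq {dx : ℝ} (hdx : 0 < dx) (μ : Measure (Ed d)) (α β : Fin d → ℤ) :
    Gup d dx μ α β = ∑ l, |gam d dx μ l| / dx *
      ((if α + Pi.single l (upwindSign dx μ l) = β then 1 else 0) - if α = β then 1 else 0) := by
  rw [Gup, Finset.mul_sum]
  refine Finset.sum_congr rfl fun l _ => ?_
  rw [← integral_const_mul, setIntegral_congr_fun (measurableSet_cell dx α)
    (fun x hx => gam_mul_Dup hdx μ l β hx), setIntegral_cell hdx]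
  simp

/-- The lattice jump measure whose generator is the discrete operator `Gw`. -/
def schemeMeasure (dx : ℝ) (μ : Measure (Ed d)) : Measure (Fin d → ℤ) :=
  driftMeasure (cellJump dx μ {z | dx / 2 < ‖z‖}) (upwindSign dx μ) fun l => |gam d dx μ l| / dx

lemma Gw_eq {dx : ℝ} (hdx : 0 < dx) (μ : Measure (Ed d))
    [IsFiniteMeasure (μ.restrict {z | dx / 2 < ‖z‖})] (α β : Fin d → ℤ) :
    Gw d dx μ α β = (schemeMeasure dx μ).real {β - α}
      - (schemeMeasure dx μ).real univ * if α = β then 1 else 0 := by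
  have hc : ∀ l, 0 ≤ |gam d dx μ l| / dx := fun l => by positivity
  have h : ∀ s : Set (Fin d → ℤ), (schemeMeasure dx μ).real s =
      (cellJump dx μ {z | dx / 2 < ‖z‖}).real s + ∑ l, |gam d dx μ l| / dx *
        s.indicator 1 (Pi.single l (upwindSign dx μ l)) := by
    intro s
    rw [← integral_indicator_one (MeasurableSet.of_discrete),
      ← integral_indicator_one (MeasurableSet.of_discrete), schemeMeasure,
      integral_driftMeasure _ _ hc (C := 1)]
    intro κ
    by_cases hκ : κ ∈ s <;> simp [hκ]
  rw [Gw, Glow, cell_average_jump hdx, Gup_eq hdx, h, h]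
  simp only [mul_sub, Finset.sum_sub_distrib, indicator_univ, Pi.one_apply, mul_one, add_mul,
    Finset.sum_mul]
  have e : ∀ l, ({β - α} : Set (Fin d → ℤ)).indicator (1 : (Fin d → ℤ) → ℝ)
      (Pi.single l (upwindSign dx μ l))
      = if α + Pi.single l (upwindSign dx μ l) = β then 1 else 0 := fun l => by
    simp [indicator_apply, eq_sub_iff_add_eq']
  simp only [e]
  ring

lemma tsum_Gw_mul {dx : ℝ} (hdx : 0 < dx) (μ : Measure (Ed d))
    [IsFiniteMeasure (μ.restrict {z | dx / 2 < ‖z‖})] {a : (Fin d → ℤ) → ℝ}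
    (ha : Summable fun α => |a α|) (α : Fin d → ℤ) :
    ∑' β, Gw d dx μ α β * a β = jumpGen (schemeMeasure dx μ) a α := by
  have hfin : IsFiniteMeasure (schemeMeasure dx μ) := by unfold schemeMeasure; infer_instance
  have hb := abs_le_toReal_l1norm (l1norm_ne_top ha)
  have hb' : Integrable (fun κ => a (α + κ)) (schemeMeasure dx μ) :=
    integrable_of_abs_le fun κ => hb (α + κ)
  rw [jumpGen, integral_sub hb' (integrable_const _),
    integral_countable hb', integral_const]
  have hs : Summable fun β => (schemeMeasure dx μ).real {β - α} * a β := by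
    refine Summable.of_norm_bounded (g := fun β => (schemeMeasure dx μ).real univ * |a β|)
      (ha.mul_left _) fun β => ?_
    rw [norm_mul, Real.norm_of_nonneg measureReal_nonneg, Real.norm_eq_abs]
    exact mul_le_mul_of_nonneg_right (measureReal_mono (subset_univ _)) (abs_nonneg _)
  have hs2 : HasSum (fun β => ((schemeMeasure dx μ).real univ * if α = β then 1 else 0) * a β)
      ((schemeMeasure dx μ).real univ * a α) := by
    convert hasSum_single α _ using 1
    · simp
    · intro β hβ
      simp [hβ.symm]
  simp_rw [Gw_eq hdx, sub_mul]
  rw [hs.tsum_sub hs2.summable, hs2.tsum_eq, smul_eq_mul,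
    ← (Equiv.addLeft α).tsum_eq fun β => (schemeMeasure dx μ).real {β - α} * a β]
  simp

end Weights

section Interpolant

variable {d : ℕ}

lemma Ubar_sub {dx : ℝ} (hdx : 0 < dx) (U V : (Fin d → ℤ) → ℝ) (x : Ed d) :
    Ubar d dx U x - Ubar d dx V x = Ubar d dx (U - V) x := by
  by_cases hx : ∃ α, x ∈ cell d dx α
  · obtain ⟨α, hα⟩ := hx
    simp [Ubar, ind_cell_of_mem hdx _ hα]
  · push Not at hx
    simp [Ubar, ind, hx]

lemma ofReal_abs_Ubar {dx : ℝ} (hdx : 0 < dx) (U : (Fin d → ℤ) → ℝ) (x : Ed d) :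
    ENNReal.ofReal |Ubar d dx U x| = ∑' α, (cell d dx α).indicator (fun _ => ‖U α‖ₑ) x := by
  by_cases hx : ∃ α, x ∈ cell d dx α
  · obtain ⟨α, hα⟩ := hx
    rw [tsum_eq_single α fun β hβ => indicator_of_notMem
      (fun h => hβ (eq_of_mem_cell hdx h hα)) _]
    simp [Ubar, ind_cell_of_mem hdx _ hα, hα, Real.enorm_eq_ofReal_abs]
  · push Not at hx
    simp [Ubar, ind, hx]

lemma integral_abs_Ubar {dx : ℝ} (hdx : 0 < dx) (U : (Fin d → ℤ) → ℝ) :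
    ∫ x, |Ubar d dx U x| = dx ^ d * (l1norm U).toReal := by
  have hmeas : Measurable fun x => ∑' α, (cell d dx α).indicator (fun _ => ‖U α‖ₑ) x :=
    Measurable.tsum fun α => measurable_const.indicator (measurableSet_cell dx α)
  calc ∫ x, |Ubar d dx U x|
      = ∫ x, (∑' α, (cell d dx α).indicator (fun _ => ‖U α‖ₑ) x).toReal := by
        simp [← ofReal_abs_Ubar hdx]
    _ = (∑' α, ‖U α‖ₑ * ENNReal.ofReal (dx ^ d)).toReal := by
        rw [integral_toReal hmeas.aemeasurable
          (ae_of_all _ fun x => by simp [← ofReal_abs_Ubar hdx]), lintegral_tsum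
          fun α => (measurable_const.indicator (measurableSet_cell dx α)).aemeasurable]
        simp [lintegral_indicator, measurableSet_cell, volume_cell hdx.le]
    _ = _ := by
        rw [ENNReal.tsum_mul_right, ENNReal.toReal_mul, ENNReal.toReal_ofReal (by positivity),
          mul_comm, l1norm]

end Interpolant

section LevyMeasure

variable {d : ℕ} {μ : Measure (Ed d)}

lemma measure_lt_norm_lt_top {p : ℕ} (h : ∫⁻ z, ENNReal.ofReal (min (‖z‖ ^ p) 1) ∂μ < ⊤) {r : ℝ}
    (hr : 0 < r) : μ {z | r < ‖z‖} < ⊤ := by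
  have hε : 0 < min (r ^ p) 1 := by positivity
  refine lt_of_le_of_lt ((measure_mono fun z (hz : r < ‖z‖) => ?_).trans
    (meas_ge_le_lintegral_div (f := fun z => ENNReal.ofReal (min (‖z‖ ^ p) 1)) (by fun_prop)
      (ENNReal.ofReal_pos.2 hε).ne' ENNReal.ofReal_ne_top))
    (ENNReal.div_lt_top h.ne (ENNReal.ofReal_pos.2 hε).ne')
  exact ENNReal.ofReal_le_ofReal (min_le_min_right _ (pow_le_pow_left₀ hr.le hz.le p))

lemma isFiniteMeasure_restrict_of_lt_norm {p : ℕ}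
    (h : ∫⁻ z, ENNReal.ofReal (min (‖z‖ ^ p) 1) ∂μ < ⊤) {r : ℝ} (hr : 0 < r) {S : Set (Ed d)}
    (hS : ∀ z ∈ S, r < ‖z‖) : IsFiniteMeasure (μ.restrict S) :=
  isFiniteMeasure_restrict.2
    (ne_top_of_le_ne_top (measure_lt_norm_lt_top h hr).ne (measure_mono hS))

lemma measure_one_lt_norm_le (p : ℕ) :
    μ {z | 1 < ‖z‖} ≤ ∫⁻ z, ENNReal.ofReal (min (‖z‖ ^ p) 1) ∂μ := by
  have := mul_meas_ge_le_lintegral (μ := μ) (f := fun z => ENNReal.ofReal (min (‖z‖ ^ p) 1))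
    (by fun_prop) 1
  rw [one_mul] at this
  refine (measure_mono fun z (hz : 1 < ‖z‖) => ?_).trans this
  simp only [mem_ofPred_eq, min_eq_right (one_le_pow₀ hz.le), ENNReal.ofReal_one, le_refl]

lemma setLIntegral_norm_pow_le (r : ℝ) (p : ℕ) :
    ∫⁻ z in {z | r < ‖z‖ ∧ ‖z‖ ≤ 1}, ENNReal.ofReal (‖z‖ ^ p) ∂μ ≤
      ∫⁻ z, ENNReal.ofReal (min (‖z‖ ^ p) 1) ∂μ := by
  refine (setLIntegral_mono (by fun_prop) fun z hz => ?_).trans (setLIntegral_le_lintegral _ _)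
  rw [min_eq_left (pow_le_one₀ (norm_nonneg z) hz.2)]

lemma abs_gam_le (dx : ℝ) (h : ∫⁻ z, ENNReal.ofReal (min ‖z‖ 1) ∂μ < ⊤) (l : Fin d) :
    |gam d dx μ l| ≤ (∫⁻ z, ENNReal.ofReal (min ‖z‖ 1) ∂μ).toReal := by
  rw [gam, abs_neg, ← Real.norm_eq_abs, ← toReal_enorm]
  refine ENNReal.toReal_mono h.ne ((enorm_integral_le_lintegral_enorm _).trans ?_)
  have := setLIntegral_norm_pow_le (μ := μ) (dx / 2) 1
  simp only [pow_one] at this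
  refine (lintegral_mono fun z => ?_).trans this
  rw [← ofReal_norm]
  exact ENNReal.ofReal_le_ofReal (PiLp.norm_apply_le z l)

end LevyMeasure

section Scheme

variable {d : ℕ} {dx : ℝ} {μ : Measure (Ed d)}

lemma cellJump_union {S T : Set (Ed d)} [IsFiniteMeasure (μ.restrict S)]
    [IsFiniteMeasure (μ.restrict T)] (hST : Disjoint S T) (hT : MeasurableSet T) :
    cellJump dx μ (S ∪ T) = cellJump dx μ S + cellJump dx μ T := by
  rw [cellJump, Measure.restrict_union hST hT, Measure.prod_add,
    Measure.map_add _ _ (measurable_cellIndex dx), cellJump, cellJump]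

lemma schemeMeasure_eq_driftMeasure_add
    [IsFiniteMeasure (μ.restrict {z | dx / 2 < ‖z‖ ∧ ‖z‖ ≤ 1})]
    [IsFiniteMeasure (μ.restrict {z | 1 < ‖z‖})] (hdx1 : dx < 1) :
    schemeMeasure dx μ = driftMeasure
      (cellJump dx μ {z | dx / 2 < ‖z‖ ∧ ‖z‖ ≤ 1} + cellJump dx μ {z | 1 < ‖z‖})
      (upwindSign dx μ) fun l => |gam d dx μ l| / dx := by
  rw [← cellJump_union, schemeMeasure]
  · congr 2
    ext z
    simp only [mem_ofPred_eq, mem_union]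
    constructor
    · intro h
      exact (le_or_gt ‖z‖ 1).imp (fun h1 => ⟨h, h1⟩) id
    · rintro (h | h)
      · exact h.1
      · linarith
  · exact disjoint_left.2 fun z hz hz' => absurd hz.2 (not_le.2 hz')
  · exact measurableSet_lt measurable_const measurable_norm

lemma eq_add_of_solvesImplicitStep (hdx : 0 < dx) [IsFiniteMeasure (μ.restrict {z | dx / 2 < ‖z‖})]
    {A : ℝ → ℝ} {dt : ℝ} {u h : (Fin d → ℤ) → ℝ} (hA : Summable fun α => |A (u α)|)
    (hu : SolvesImplicitStep d dx μ A dt u h) :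
    u = h + dt • jumpGen (schemeMeasure dx μ) (A ∘ u) := by
  funext α
  have h1 := (hu α).2
  have h2 := tsum_Gw_mul hdx μ (a := A ∘ u) hA α
  simp only [Function.comp_apply] at h2
  rw [h2] at h1
  simp [← h1]

end Scheme

section TimeRegularity

variable {d : ℕ} {μ : Measure (Ed d)} {LA M B : ℝ} {A : ℝ → ℝ} {dx dt : ℝ}
  {U : ℕ → (Fin d → ℤ) → ℝ}

lemma Aok.nonneg (hA : Aok A LA) : 0 ≤ LA := by
  simpa using (abs_nonneg _).trans (hA.2.1 1 0)

lemma Aok.summable_comp (hA : Aok A LA) {u : (Fin d → ℤ) → ℝ} (hu : Summable fun α => |u α|) :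
    Summable fun α => |A (u α)| :=
  Summable.of_nonneg_of_le (fun _ => abs_nonneg _)
    (fun α => by simpa [hA.2.2] using hA.2.1 (u α) 0) (hu.mul_left LA)

lemma l1norm_le_of_integral_abs_Ubar_le (hdx : 0 < dx) {u : (Fin d → ℤ) → ℝ}
    (hu : Summable fun α => |u α|) (h : ∫ x, |Ubar d dx u x| ≤ M) :
    l1norm u ≤ ENNReal.ofReal (M / dx ^ d) := by
  rw [integral_abs_Ubar hdx] at h
  rw [← ENNReal.ofReal_toReal (l1norm_ne_top hu)]
  refine ENNReal.ofReal_le_ofReal ((le_div_iff₀ (by positivity)).2 ?_)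
  linarith

lemma l1norm_shift_single_sub_self_le (hd : 1 ≤ d) (hdx : 0 < dx) {u : (Fin d → ℤ) → ℝ}
    (hu : Summable fun α => |u α|) {l : Fin d}
    (h : dx ^ (d - 1) * ∑' α, |u α - u (α - Pi.single l 1)| ≤ B) :
    l1norm (shift (Pi.single l 1) u - u) ≤ ENNReal.ofReal (B * dx / dx ^ d) := by
  have hs : Summable fun α => |u (α - Pi.single l 1)| :=
    hu.comp_injective (i := fun α => α - Pi.single l 1) (sub_left_injective (b := Pi.single l 1))
  have e : shift (-Pi.single l 1) u = fun α => u (α - Pi.single l 1) := by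
    funext α
    simp [shift, sub_eq_add_neg]
  have hs' : Summable fun α => |(u - shift (-Pi.single l 1) u) α| := by
    rw [e]
    exact Summable.of_nonneg_of_le (fun _ => abs_nonneg _)
      (fun α => norm_sub_le (u α) (u (α - Pi.single l 1))) (hu.add hs)
  rw [← l1norm_shift_neg_sub_self, l1norm_sub_comm, l1norm_eq_ofReal_tsum hs']
  refine ENNReal.ofReal_le_ofReal ((le_div_iff₀ (by positivity)).2 ?_)
  have hpow : dx ^ d = dx ^ (d - 1) * dx := by rw [← pow_succ, Nat.sub_add_cancel hd]
  simp only [Pi.sub_apply, e]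
  rw [hpow]
  nlinarith

/-- The standing assumptions on a solution of the implicit scheme. -/
structure IsImplicitSolution (μ : Measure (Ed d)) (LA M B : ℝ) (A : ℝ → ℝ) (dx dt : ℝ)
    (U : ℕ → (Fin d → ℤ) → ℝ) : Prop where
  aok : Aok A LA
  dx_pos : 0 < dx
  dx_lt_one : dx < 1
  dt_pos : 0 < dt
  summable : ∀ n, Summable fun α => |U n α|
  step : ∀ n, SolvesImplicitStep d dx μ A dt (U (n + 1)) (U n)
  mass : ∫ x, |Ubar d dx (U 0) x| ≤ M
  variation : ∀ l : Fin d, dx ^ (d - 1) * ∑' α, |U 0 α - U 0 (α - Pi.single l 1)| ≤ B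

namespace IsImplicitSolution

lemma step_eq (h : IsImplicitSolution μ LA M B A dx dt U)
    [IsFiniteMeasure (μ.restrict {z | dx / 2 < ‖z‖ ∧ ‖z‖ ≤ 1})]
    [IsFiniteMeasure (μ.restrict {z | dx / 2 < ‖z‖})] [IsFiniteMeasure (μ.restrict {z | 1 < ‖z‖})]
    (n : ℕ) : U (n + 1) = U n + dt • jumpGen (driftMeasure
      (cellJump dx μ {z | dx / 2 < ‖z‖ ∧ ‖z‖ ≤ 1} + cellJump dx μ {z | 1 < ‖z‖})
      (upwindSign dx μ) fun l => |gam d dx μ l| / dx) (A ∘ U (n + 1)) := by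
  rw [← schemeMeasure_eq_driftMeasure_add h.dx_lt_one]
  exact eq_add_of_solvesImplicitStep h.dx_pos (h.aok.summable_comp (h.summable _)) (h.step n)

lemma integral_le_centered (h : IsImplicitSolution μ LA M B A dx dt U) (hd : 1 ≤ d)
    (hM : 0 ≤ M) (hB : 0 ≤ B) (hμ : ∫⁻ z, ENNReal.ofReal (min (‖z‖ ^ 2) 1) ∂μ < ⊤)
    {k : ℕ} (hk : k ≠ 0) (m j : ℕ) :
    ∫ x, |Ubar d dx (U (m + j)) x - Ubar d dx (U m) x| ≤
      2 * (d * ((k - 1 : ℕ) * (B * dx))) +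
      j * dt * (2 * (LA * M) * (∫⁻ z, ENNReal.ofReal (min (‖z‖ ^ 2) 1) ∂μ).toReal +
        (3 * d / dx) ^ 2 * (∫⁻ z, ENNReal.ofReal (min (‖z‖ ^ 2) 1) ∂μ).toReal *
          (2 * ((k : ℝ)⁻¹ * (2 * (LA * (B * dx)))))) := by
  have hdx := h.dx_pos
  have hdt := h.dt_pos.le
  have hLA := h.aok.nonneg
  have hfin₀ : IsFiniteMeasure (μ.restrict {z | dx / 2 < ‖z‖}) :=
    isFiniteMeasure_restrict_of_lt_norm hμ (half_pos hdx) fun z hz => hz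
  have hfin₁ : IsFiniteMeasure (μ.restrict {z | dx / 2 < ‖z‖ ∧ ‖z‖ ≤ 1}) :=
    isFiniteMeasure_restrict_of_lt_norm hμ (half_pos hdx) fun z hz => hz.1
  have hfin₂ : IsFiniteMeasure (μ.restrict {z | 1 < ‖z‖}) :=
    isFiniteMeasure_restrict_of_lt_norm hμ one_pos fun z hz => hz
  have hmom := lintegral_latticeLen_pow_cellJump_le hdx μ
    (S := {z | dx / 2 < ‖z‖ ∧ ‖z‖ ≤ 1}) (fun z hz => hz.1)
  have hint : ∀ l, Integrable (fun κ : Fin d → ℤ => (κ l : ℝ))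
      (cellJump dx μ {z | dx / 2 < ‖z‖ ∧ ‖z‖ ≤ 1}) := by
    refine integrable_coord_of_lintegral_latticeLen _ ?_
    have h1 := hmom 1
    simp only [pow_one] at h1
    refine ne_top_of_le_ne_top (ENNReal.mul_ne_top ENNReal.ofReal_ne_top ?_) h1
    refine ne_top_of_le_ne_top (measure_ne_top (μ.restrict {z | dx / 2 < ‖z‖ ∧ ‖z‖ ≤ 1}) univ) ?_
    rw [← lintegral_one]
    exact setLIntegral_mono measurable_one fun z hz => ENNReal.ofReal_le_one.2 hz.2
  have hcs : ∀ l, |gam d dx μ l| / dx = -(upwindSign dx μ l *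
      ∫ κ, (κ l : ℝ) ∂cellJump dx μ {z | dx / 2 < ‖z‖ ∧ ‖z‖ ≤ 1}) := fun l => by
    rw [integral_coord_cellJump dx μ _ l (hint l), ← upwindSign_mul_gam, gam]
    ring
  have key := l1norm_implicitScheme_sub_le_of_centered (upwindSign_eq dx μ)
    (fun l => by positivity) hint hcs h.aok.1 h.aok.2.1 h.aok.2.2 hdt
    (fun n => l1norm_ne_top (h.summable n)) h.step_eq
    (fun l => l1norm_shift_single_sub_self_le hd hdx (h.summable 0) (h.variation l)) hk m j
  have hk' : ‖(k : ℝ)⁻¹‖ₑ = ENNReal.ofReal (k : ℝ)⁻¹ :=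
    Real.enorm_of_nonneg (by positivity)
  have hle : l1norm (U (m + j) - U m) ≤ ENNReal.ofReal (
      2 * (d * ((k - 1 : ℕ) * (B * dx / dx ^ d))) +
      j * dt * (2 * (LA * (M / dx ^ d)) * (∫⁻ z, ENNReal.ofReal (min (‖z‖ ^ 2) 1) ∂μ).toReal +
        (3 * d / dx) ^ 2 * (∫⁻ z, ENNReal.ofReal (min (‖z‖ ^ 2) 1) ∂μ).toReal *
          (2 * ((k : ℝ)⁻¹ * (2 * (LA * (B * dx / dx ^ d))))))) := by
    simp (disch := positivity) only [ENNReal.ofReal_add, ENNReal.ofReal_mul, ENNReal.ofReal_natCast,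
      ENNReal.ofReal_ofNat, ENNReal.ofReal_toReal hμ.ne]
    rw [hk', ENNReal.ofReal_mul (Nat.cast_nonneg j), ENNReal.ofReal_natCast, cellJump_univ] at key
    refine key.trans ?_
    gcongr
    · exact l1norm_le_of_integral_abs_Ubar_le hdx (h.summable 0) h.mass
    · exact measure_one_lt_norm_le 2
    · exact (hmom 2).trans (mul_le_mul' le_rfl (setLIntegral_norm_pow_le _ 2))
  simp_rw [Ubar_sub hdx]
  rw [integral_abs_Ubar hdx]
  refine (mul_le_mul_of_nonneg_left (ENNReal.toReal_le_of_le_ofReal (by positivity) hle)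
    (by positivity)).trans_eq ?_
  field_simp

lemma integral_le_drift (h : IsImplicitSolution μ LA M B A dx dt U) (hd : 1 ≤ d)
    (hM : 0 ≤ M) (hB : 0 ≤ B) (hμ : ∫⁻ z, ENNReal.ofReal (min ‖z‖ 1) ∂μ < ⊤) (m j : ℕ) :
    ∫ x, |Ubar d dx (U (m + j)) x - Ubar d dx (U m) x| ≤
      j * dt * (2 * (LA * M) * (∫⁻ z, ENNReal.ofReal (min ‖z‖ 1) ∂μ).toReal +
        4 * d * (∫⁻ z, ENNReal.ofReal (min ‖z‖ 1) ∂μ).toReal * (LA * B)) := by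
  have hdx := h.dx_pos
  have hdt := h.dt_pos.le
  have hLA := h.aok.nonneg
  have hμ' : ∫⁻ z, ENNReal.ofReal (min (‖z‖ ^ 1) 1) ∂μ < ⊤ := by simpa using hμ
  have hfin₀ : IsFiniteMeasure (μ.restrict {z | dx / 2 < ‖z‖}) :=
    isFiniteMeasure_restrict_of_lt_norm hμ' (half_pos hdx) fun z hz => hz
  have hfin₁ : IsFiniteMeasure (μ.restrict {z | dx / 2 < ‖z‖ ∧ ‖z‖ ≤ 1}) :=
    isFiniteMeasure_restrict_of_lt_norm hμ' (half_pos hdx) fun z hz => hz.1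
  have hfin₂ : IsFiniteMeasure (μ.restrict {z | 1 < ‖z‖}) :=
    isFiniteMeasure_restrict_of_lt_norm hμ' one_pos fun z hz => hz
  have hmom : ∫⁻ κ, latticeLen κ ∂cellJump dx μ {z | dx / 2 < ‖z‖ ∧ ‖z‖ ≤ 1} ≤
      ENNReal.ofReal (3 * d / dx) * ∫⁻ z, ENNReal.ofReal (min ‖z‖ 1) ∂μ := by
    have := (lintegral_latticeLen_pow_cellJump_le hdx μ
      (S := {z | dx / 2 < ‖z‖ ∧ ‖z‖ ≤ 1}) (fun z hz => hz.1) 1).trans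
        (mul_le_mul' le_rfl (setLIntegral_norm_pow_le _ 1))
    simpa only [pow_one] using this
  have hfar : μ {z | 1 < ‖z‖} ≤ ∫⁻ z, ENNReal.ofReal (min ‖z‖ 1) ∂μ := by
    simpa only [pow_one] using measure_one_lt_norm_le (μ := μ) 1
  have hdrift : ∑ l, ENNReal.ofReal (|gam d dx μ l| / dx) ≤
      ENNReal.ofReal (d / dx) * ∫⁻ z, ENNReal.ofReal (min ‖z‖ 1) ∂μ := by
    rw [← ENNReal.ofReal_sum_of_nonneg fun l _ => by positivity, ← ENNReal.ofReal_toReal hμ.ne,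
      ← ENNReal.ofReal_mul (by positivity)]
    refine ENNReal.ofReal_le_ofReal ((Finset.sum_le_sum fun l _ =>
      div_le_div_of_nonneg_right (abs_gam_le dx hμ l) hdx.le).trans_eq ?_)
    simp
    ring
  have key := l1norm_implicitScheme_sub_le_of_drift (upwindSign_eq dx μ) h.aok.1 h.aok.2.1
    h.aok.2.2 hdt (fun n => l1norm_ne_top (h.summable n)) h.step_eq
    (fun l => l1norm_shift_single_sub_self_le hd hdx (h.summable 0) (h.variation l)) m j
  have hle : l1norm (U (m + j) - U m) ≤ ENNReal.ofReal (j * dt *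
      (2 * (LA * (M / dx ^ d)) * (∫⁻ z, ENNReal.ofReal (min ‖z‖ 1) ∂μ).toReal +
        (3 * d / dx * (∫⁻ z, ENNReal.ofReal (min ‖z‖ 1) ∂μ).toReal +
          d / dx * (∫⁻ z, ENNReal.ofReal (min ‖z‖ 1) ∂μ).toReal) * (LA * (B * dx / dx ^ d)))) := by
    have h3 : 0 ≤ 3 * d / dx := by positivity
    have h1 : 0 ≤ d / dx := by positivity
    generalize 3 * d / dx = c₃ at hmom h3 ⊢
    generalize d / dx = c₁ at hdrift h1 ⊢
    simp (disch := positivity) only [ENNReal.ofReal_add, ENNReal.ofReal_mul, ENNReal.ofReal_natCast,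
      ENNReal.ofReal_ofNat, ENNReal.ofReal_toReal hμ.ne]
    rw [ENNReal.ofReal_mul (Nat.cast_nonneg j), ENNReal.ofReal_natCast, cellJump_univ] at key
    refine key.trans ?_
    gcongr
    exact l1norm_le_of_integral_abs_Ubar_le hdx (h.summable 0) h.mass
  simp_rw [Ubar_sub hdx]
  rw [integral_abs_Ubar hdx]
  refine (mul_le_mul_of_nonneg_left (ENNReal.toReal_le_of_le_ofReal (by positivity) hle)
    (by positivity)).trans_eq ?_
  field_simp
  ring

lemma integral_le_two_mul_mass (h : IsImplicitSolution μ LA M B A dx dt U)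
    (hM : 0 ≤ M) (hμ : ∫⁻ z, ENNReal.ofReal (min (‖z‖ ^ 2) 1) ∂μ < ⊤) (m n : ℕ) :
    ∫ x, |Ubar d dx (U n) x - Ubar d dx (U m) x| ≤ 2 * M := by
  have hdx := h.dx_pos
  have hfin₀ : IsFiniteMeasure (μ.restrict {z | dx / 2 < ‖z‖}) :=
    isFiniteMeasure_restrict_of_lt_norm hμ (half_pos hdx) fun z hz => hz
  have hfin₁ : IsFiniteMeasure (μ.restrict {z | dx / 2 < ‖z‖ ∧ ‖z‖ ≤ 1}) :=
    isFiniteMeasure_restrict_of_lt_norm hμ (half_pos hdx) fun z hz => hz.1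
  have hfin₂ : IsFiniteMeasure (μ.restrict {z | 1 < ‖z‖}) :=
    isFiniteMeasure_restrict_of_lt_norm hμ one_pos fun z hz => hz
  have hmass : ∀ n, l1norm (U n) ≤ ENNReal.ofReal (M / dx ^ d) := fun n =>
    (l1norm_implicitScheme_le h.aok.1 h.aok.2.1 h.aok.2.2 h.dt_pos.le
      (fun n => l1norm_ne_top (h.summable n)) h.step_eq n).trans
      (l1norm_le_of_integral_abs_Ubar_le hdx (h.summable 0) h.mass)
  have hle : l1norm (U n - U m) ≤ ENNReal.ofReal (M / dx ^ d + M / dx ^ d) := by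
    rw [ENNReal.ofReal_add (by positivity) (by positivity)]
    exact (l1norm_sub_le _ _).trans (add_le_add (hmass n) (hmass m))
  simp_rw [Ubar_sub hdx]
  rw [integral_abs_Ubar hdx]
  refine (mul_le_mul_of_nonneg_left (ENNReal.toReal_le_of_le_ofReal (by positivity) hle)
    (by positivity)).trans_eq ?_
  field_simp
  ring

lemma integral_le_sqrt (h : IsImplicitSolution μ LA M B A dx dt U) (hd : 1 ≤ d)
    (hM : 0 ≤ M) (hB : 0 ≤ B) (hμ : ∫⁻ z, ENNReal.ofReal (min (‖z‖ ^ 2) 1) ∂μ < ⊤) (m j : ℕ) :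
    ∫ x, |Ubar d dx (U (m + j)) x - Ubar d dx (U m) x| ≤
      (2 * M + 2 * d * B + 2 * LA * M * (∫⁻ z, ENNReal.ofReal (min (‖z‖ ^ 2) 1) ∂μ).toReal +
        36 * d ^ 2 * (∫⁻ z, ENNReal.ofReal (min (‖z‖ ^ 2) 1) ∂μ).toReal * LA * B)
        * √(j * dt) := by
  have hcent := fun k hk => h.integral_le_centered hd hM hB hμ (k := k) hk m j
  have hmass := h.integral_le_two_mul_mass hM hμ m (m + j)
  have hdx := h.dx_pos
  have hdt := h.dt_pos
  have hLA := h.aok.nonneg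
  have hI : 0 ≤ (∫⁻ z, ENNReal.ofReal (min (‖z‖ ^ 2) 1) ∂μ).toReal := ENNReal.toReal_nonneg
  generalize (∫⁻ z, ENNReal.ofReal (min (‖z‖ ^ 2) 1) ∂μ).toReal = I at *
  rcases Nat.eq_zero_or_pos j with rfl | hj
  · simp
  have hT : 0 < j * dt := by positivity
  generalize (j : ℝ) * dt = T at *
  have hs : 0 < √T := Real.sqrt_pos.2 hT
  have hsq : √T ^ 2 = T := Real.sq_sqrt hT.le
  generalize √T = s at *
  subst hsq
  rcases le_total 1 s with h1 | h1
  · refine hmass.trans ?_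
    calc 2 * M ≤ 2 * M * s := le_mul_of_one_le_right (by positivity) h1
      _ ≤ _ := by gcongr; linarith [show 0 ≤ 2 * d * B + 2 * LA * M * I + 36 * d ^ 2 * I * LA * B
                    by positivity]
  · set k := ⌈s / dx⌉₊ with hkdef
    have hk : 0 < k := Nat.ceil_pos.2 (by positivity)
    have hk1 : ((k - 1 : ℕ) : ℝ) * dx ≤ s := by
      rw [Nat.cast_sub hk, Nat.cast_one, ← le_div_iff₀ hdx]
      linarith [Nat.ceil_lt_add_one (show 0 ≤ s / dx by positivity)]
    have hk2 : (k : ℝ)⁻¹ ≤ dx / s := by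
      rw [← inv_div]
      exact inv_anti₀ (by positivity) (Nat.le_ceil _)
    refine (hcent k hk.ne').trans ?_
    calc _ = 2 * (d * B * ((k - 1 : ℕ) * dx)) + (2 * (LA * M) * I) * (s * s) +
          s ^ 2 * ((3 * d / dx) ^ 2 * I * (2 * ((k : ℝ)⁻¹ * (2 * (LA * (B * dx)))))) := by ring
      _ ≤ 2 * (d * B * s) + (2 * (LA * M) * I) * (s * 1) +
          s ^ 2 * ((3 * d / dx) ^ 2 * I * (2 * (dx / s * (2 * (LA * (B * dx)))))) := by gcongr
      _ = (2 * d * B + 2 * LA * M * I + 36 * d ^ 2 * I * LA * B) * s := by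
          field_simp
          ring
      _ ≤ _ := by gcongr; linarith

end IsImplicitSolution

end TimeRegularity

theorem stmt16 (d : ℕ) (hd : 1 ≤ d)
    (μ : Measure (Ed d)) (hμ0 : μ {0} = 0)
    (hμfin : ∫⁻ z, ENNReal.ofReal (min (‖z‖ ^ 2) 1) ∂μ < ⊤)
    (LA M B : ℝ) (hM : 0 ≤ M) (hB : 0 ≤ B) :
    (∃ C : ℝ, 0 < C ∧
      ∀ (A : ℝ → ℝ), Aok A LA →
      ∀ (dx : ℝ), 0 < dx → dx < 1 →
      ∀ (dt : ℝ), 0 < dt →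
      ∀ (U : ℕ → (Fin d → ℤ) → ℝ),
        (∀ n : ℕ, Summable fun α => |U n α|) →
        (∀ n : ℕ, SolvesImplicitStep d dx μ A dt (U (n + 1)) (U n)) →
        (∫ x, |Ubar d dx (U 0) x|) ≤ M →
        (∀ l : Fin d,
          dx ^ (d - 1) * ∑' α : Fin d → ℤ, |U 0 α - U 0 (α - Pi.single l 1)| ≤ B) →
        ∀ n m : ℕ,
          (∫ x, |Ubar d dx (U n) x - Ubar d dx (U m) x|) ≤
            C * Real.sqrt (|(n : ℝ) - (m : ℝ)| * dt)) ∧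
    ((∫⁻ z, ENNReal.ofReal (min ‖z‖ 1) ∂μ < ⊤) →
      ∃ C' : ℝ, 0 < C' ∧
      ∀ (A : ℝ → ℝ), Aok A LA →
      ∀ (dx : ℝ), 0 < dx → dx < 1 →
      ∀ (dt : ℝ), 0 < dt →
      ∀ (U : ℕ → (Fin d → ℤ) → ℝ),
        (∀ n : ℕ, Summable fun α => |U n α|) →
        (∀ n : ℕ, SolvesImplicitStep d dx μ A dt (U (n + 1)) (U n)) →
        (∫ x, |Ubar d dx (U 0) x|) ≤ M →
        (∀ l : Fin d,
          dx ^ (d - 1) * ∑' α : Fin d → ℤ, |U 0 α - U 0 (α - Pi.single l 1)| ≤ B) →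
        ∀ n m : ℕ,
          (∫ x, |Ubar d dx (U n) x - Ubar d dx (U m) x|) ≤
            C' * (|(n : ℝ) - (m : ℝ)| * dt)) := by
  have of_add : ∀ {F : ℕ → ℕ → ℝ} {g : ℝ → ℝ} {dt : ℝ}, (∀ n m, F n m = F m n) →
      (∀ m j : ℕ, F (m + j) m ≤ g (j * dt)) →
      ∀ n m : ℕ, F n m ≤ g (|(n : ℝ) - m| * dt) := by
    intro F g dt hF h n m
    rcases le_total m n with hmn | hmn <;> obtain ⟨j, rfl⟩ := Nat.exists_eq_add_of_le hmn
    · simpa using h m j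
    · rw [hF]
      simpa using h n j
  have hsymm : ∀ (dx : ℝ) (U : ℕ → (Fin d → ℤ) → ℝ) (n m : ℕ),
      ∫ x, |Ubar d dx (U n) x - Ubar d dx (U m) x| =
        ∫ x, |Ubar d dx (U m) x - Ubar d dx (U n) x| := fun dx U n m => by
    simp only [abs_sub_comm]
  constructor
  · refine ⟨2 * M + 2 * d * B +
      2 * |LA| * M * (∫⁻ z, ENNReal.ofReal (min (‖z‖ ^ 2) 1) ∂μ).toReal +
      36 * d ^ 2 * (∫⁻ z, ENNReal.ofReal (min (‖z‖ ^ 2) 1) ∂μ).toReal * |LA| * B + 1,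
      by positivity, ?_⟩
    intro A hA dx hdx hdx1 dt hdt U hU hstep hmass hvar
    have h : IsImplicitSolution μ LA M B A dx dt U := ⟨hA, hdx, hdx1, hdt, hU, hstep, hmass, hvar⟩
    rw [abs_of_nonneg hA.nonneg]
    refine of_add (g := fun t => _ * √t) (hsymm dx U) fun m j =>
      (h.integral_le_sqrt hd hM hB hμfin m j).trans ?_
    exact mul_le_mul_of_nonneg_right (le_add_of_nonneg_right zero_le_one) (Real.sqrt_nonneg _)
  · intro hμ1
    refine ⟨2 * (|LA| * M) * (∫⁻ z, ENNReal.ofReal (min ‖z‖ 1) ∂μ).toReal +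
      4 * d * (∫⁻ z, ENNReal.ofReal (min ‖z‖ 1) ∂μ).toReal * (|LA| * B) + 1, by positivity, ?_⟩
    intro A hA dx hdx hdx1 dt hdt U hU hstep hmass hvar
    have h : IsImplicitSolution μ LA M B A dx dt U := ⟨hA, hdx, hdx1, hdt, hU, hstep, hmass, hvar⟩
    rw [abs_of_nonneg hA.nonneg]
    refine of_add (g := fun t => _ * t) (hsymm dx U) fun m j =>
      (h.integral_le_drift hd hM hB hμ1 m j).trans ?_
    rw [mul_comm]
    exact mul_le_mul_of_nonneg_right (le_add_of_nonneg_right zero_le_one) (by positivity)
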